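/- arXiv:1706.04950 — 7 statements merged into one kernel-verified Lean document; each statement's English description precedes it below -/
import Mathlib

section
/- For every sufficiently small ε > 0 there exists a constant C such that, when n is sufficiently large, the following holds. Let G be a properly edge-colored graph on n vertices with minimum degree δ(G) ≥ (1 - δ)n for some δ = δ(n) > 0, and let A, B be disjoint vertex subsets of sizes a and b respectively with a ≤ b. If y divides both a and b, b ≥ max{ C y^2, C δ n }, and y ≥ C, then there exists a partition {A_i} of A into parts of size y and a partition {B_j} of B into parts of size y such that all but at most ε·(a b)/y^2 of the pairs (A_i, B_j) are ε-nearly-rainbow. -/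
open scoped Classical

/-- An edge-coloring of a graph is a *proper edge-coloring* if the edges incident to any
single vertex receive pairwise distinct colors. -/
def IsProperEdgeColoring {V : Type*} (G : SimpleGraph V) (c : Sym2 V → ℕ) : Prop :=
  ∀ ⦃e₁ e₂ : Sym2 V⦄, e₁ ∈ G.edgeSet → e₂ ∈ G.edgeSet → e₁ ≠ e₂ →
    (∃ v, v ∈ e₁ ∧ v ∈ e₂) → c e₁ ≠ c e₂

/-- `colorsBetween G c A B` is the number of distinct colors appearing on the edges of `G`
with one endpoint in `A` and the other endpoint in `B`. -/
noncomputable def colorsBetween {V : Type*} (G : SimpleGraph V) (c : Sym2 V → ℕ)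
    (A B : Finset V) : ℕ :=
  (c '' {e : Sym2 V | e ∈ G.edgeSet ∧ ∃ u ∈ A, ∃ v ∈ B, e = s(u, v)}).ncard

/-- A pair of disjoint vertex sets `A`, `B` is `ε`-nearly-rainbow if at least
`(1 - ε)|A||B|` distinct colors appear on the edges of `G` between `A` and `B`. -/
def NearlyRainbow {V : Type*} (ε : ℝ) (G : SimpleGraph V) (c : Sym2 V → ℕ)
    (A B : Finset V) : Prop :=
  (1 - ε) * A.card * B.card ≤ (colorsBetween G c A B : ℝ)


lemma aux_fiber {β : Type*} [Fintype β] [DecidableEq β] (k y : ℕ)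
    (hk : Fintype.card β = k * y) (W : β → β → ℕ) (hW : ∀ w, W w w = 0) :
    ∃ g : β → Fin k, (∀ j, (Finset.univ.filter fun x => g x = j).card = y) ∧
      (k * y - 1) * ∑ w, ∑ x, (if g w = g x then W w x else 0) ≤
        (y - 1) * ∑ w, ∑ x, W w x := by
  have e : β ≃ Fin k × Fin y := Fintype.equivOfCardEq (by simp [hk])
  have hfib : ∀ (π : Equiv.Perm β) (j : Fin k),
      (Finset.univ.filter fun x => (e (π x)).1 = j).card = y := by
    intro π j
    have : (Finset.univ.filter fun x => (e (π x)).1 = j) =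
        (Finset.univ : Finset (Fin y)).image (fun i => π.symm (e.symm (j, i))) := by
      ext x
      simp only [Finset.mem_filter, Finset.mem_univ, true_and, Finset.mem_image]
      constructor
      · intro h
        refine ⟨(e (π x)).2, ?_⟩
        rw [← h]; simp
      · rintro ⟨i, rfl⟩; simp
    rw [this, Finset.card_image_of_injective]
    · simp
    · intro i i' h
      simpa using h
  by_contra hcon
  push Not at hcon
  have hlt := fun π : Equiv.Perm β => hcon (fun x => (e (π x)).1) (hfib π)
  have hsum : ∑ π : Equiv.Perm β, (y - 1) * ∑ w, ∑ x, W w x <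
      ∑ π : Equiv.Perm β, (k * y - 1) *
        ∑ w, ∑ x, (if (e (π w)).1 = (e (π x)).1 then W w x else 0) :=
    Finset.sum_lt_sum_of_nonempty ⟨1, Finset.mem_univ _⟩ (fun π _ => hlt π)
  have key : ∀ w x : β, w ≠ x →
      (k * y - 1) * ∑ π : Equiv.Perm β, (if (e (π w)).1 = (e (π x)).1 then 1 else 0) =
        ∑ π : Equiv.Perm β, (y - 1) := by
    intro w x hwx
    have h1 : ∀ x' ∈ Finset.univ.erase w,
        ∑ π : Equiv.Perm β, (if (e (π w)).1 = (e (π x')).1 then 1 else 0) =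
        ∑ π : Equiv.Perm β, (if (e (π w)).1 = (e (π x)).1 then 1 else 0) := by
      intro x' hx'
      have hx'w : x' ≠ w := by simpa using hx'
      refine Fintype.sum_equiv (Equiv.mulRight (Equiv.swap x x')) _ _ ?_
      intro π
      simp [Equiv.swap_apply_of_ne_of_ne hwx hx'w.symm]
    have h2 := Finset.sum_const_nat h1
    rw [Finset.card_erase_of_mem (Finset.mem_univ _), Finset.card_univ, hk] at h2
    rw [← h2, Finset.sum_comm]
    refine Finset.sum_congr rfl fun π _ => ?_
    rw [Finset.sum_boole]
    have := hfib π (e (π w)).1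
    rw [Nat.cast_id]
    refine Eq.trans ?_ (congrArg (· - 1) this)
    refine Eq.trans ?_ (Finset.card_erase_of_mem (a := w) (by simp))
    congr 1
    ext z
    simp [eq_comm]
  have hEq : ∑ π : Equiv.Perm β, (k * y - 1) *
        ∑ w, ∑ x, (if (e (π w)).1 = (e (π x)).1 then W w x else 0) =
      ∑ π : Equiv.Perm β, (y - 1) * ∑ w, ∑ x, W w x := by
    rw [← Finset.mul_sum, Finset.sum_comm, ← Finset.sum_mul, Finset.mul_sum, Finset.mul_sum]
    refine Finset.sum_congr rfl fun w _ => ?_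
    rw [Finset.sum_comm, Finset.mul_sum, Finset.mul_sum]
    refine Finset.sum_congr rfl fun x _ => ?_
    by_cases hwx : w = x
    · subst hwx; simp [hW]
    · rw [← key w x hwx, mul_assoc, Finset.sum_mul]
      simp
  omega

lemma aux_partition {V : Type*} [DecidableEq V] (B : Finset V) (y : ℕ) (hy : 0 < y)
    (hd : y ∣ B.card) (W : V → V → ℕ) (hW : ∀ w, W w w = 0) :
    ∃ P : Finset (Finset V), (∀ s ∈ P, s ⊆ B ∧ s.card = y) ∧
      (P : Set (Finset V)).PairwiseDisjoint id ∧ P.biUnion id = B ∧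
      (B.card - 1) * ∑ t ∈ P, ∑ w ∈ t, ∑ x ∈ t, W w x ≤
        (y - 1) * ∑ w ∈ B, ∑ x ∈ B, W w x := by
  obtain ⟨k, hk⟩ := hd
  rw [mul_comm] at hk
  obtain ⟨g, hg, hsum⟩ := aux_fiber (β := B) k y (by simpa using hk)
    (fun w x => W w x) (fun w => hW w)
  let part : Fin k → Finset V := fun j =>
    (Finset.univ.filter fun x : B => g x = j).map (Function.Embedding.subtype _)
  have hmem : ∀ j v, v ∈ part j ↔ ∃ h : v ∈ B, g ⟨v, h⟩ = j := by
    intro j v; simp [part]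
  have hcard : ∀ j, (part j).card = y := by
    intro j
    simp only [part, Finset.card_map]
    exact hg j
  have hdisj : ∀ i j, i ≠ j → Disjoint (part i) (part j) := by
    intro i j hij
    rw [Finset.disjoint_left]
    intro v h1 h2
    rw [hmem] at h1 h2
    obtain ⟨h, h1⟩ := h1
    obtain ⟨_, h2⟩ := h2
    exact hij (h1.symm.trans h2)
  have hinj : Function.Injective part := by
    intro i j hij
    by_contra hne
    have h := hdisj i j hne
    rw [hij, disjoint_self] at h
    have := hcard j
    rw [h] at this
    simp at this
    omega
  refine ⟨Finset.univ.image part, ?_, ?_, ?_, ?_⟩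
  · intro s hs
    obtain ⟨j, -, rfl⟩ := Finset.mem_image.1 hs
    refine ⟨fun v hv => ?_, hcard j⟩
    exact ((hmem _ _).1 hv).1
  · intro s hs t ht hst
    simp only [Finset.coe_image, Finset.coe_univ, Set.image_univ, Set.mem_range] at hs ht
    obtain ⟨i, rfl⟩ := hs
    obtain ⟨j, rfl⟩ := ht
    exact hdisj i j (fun h => hst (by rw [h]))
  · ext v
    simp only [Finset.mem_biUnion, Finset.mem_image, Finset.mem_univ, true_and, id]
    constructor
    · rintro ⟨_, ⟨j, rfl⟩, hv⟩
      exact ((hmem _ _).1 hv).1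
    · intro hv
      exact ⟨_, ⟨g ⟨v, hv⟩, rfl⟩, (hmem _ _).2 ⟨hv, rfl⟩⟩
  · rw [Finset.sum_image (fun _ _ _ _ h => hinj h), hk]
    have e1 : ∑ j, ∑ w ∈ part j, ∑ x ∈ part j, W w x =
        ∑ w : B, ∑ x : B, (if g w = g x then W w x else 0) := by
      simp only [part, Finset.sum_map, Function.Embedding.subtype_apply]
      rw [← Finset.sum_fiberwise Finset.univ g]
      refine Finset.sum_congr rfl fun j _ => Finset.sum_congr rfl fun w hw => ?_
      rw [Finset.sum_filter]
      have : g w = j := by simpa using hw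
      refine Finset.sum_congr rfl fun x _ => ?_
      rw [this]
      simp [eq_comm]
    have e2 : ∑ w ∈ B, ∑ x ∈ B, W w x = ∑ w : B, ∑ x : B, W w x := by
      rw [← Finset.sum_coe_sort B]
      refine Finset.sum_congr rfl fun w _ => ?_
      rw [← Finset.sum_coe_sort B]
    rw [e1, e2]
    exact hsum

lemma aux_image {E : Type*} [DecidableEq E] (S : Finset E) (c : E → ℕ) :
    S.card ≤ (S.image c).card +
      ∑ e ∈ S, ∑ f ∈ S, (if e ≠ f ∧ c e = c f then 1 else 0) := by
  induction S using Finset.induction_on with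
  | empty => simp
  | insert a S ha ih =>
    have hmono : ∑ e ∈ S, ∑ f ∈ S, (if e ≠ f ∧ c e = c f then 1 else 0) ≤
        ∑ e ∈ S, ∑ f ∈ insert a S, (if e ≠ f ∧ c e = c f then 1 else 0) :=
      Finset.sum_le_sum fun e _ =>
        Finset.sum_le_sum_of_subset (Finset.subset_insert _ _)
    rw [Finset.card_insert_of_notMem ha, Finset.sum_insert ha, Finset.image_insert]
    by_cases h : c a ∈ S.image c
    · rw [Finset.insert_eq_of_mem h]
      obtain ⟨f, hf, hfa⟩ := Finset.mem_image.1 h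
      have : 1 ≤ ∑ f ∈ insert a S, (if a ≠ f ∧ c a = c f then 1 else 0) := by
        have h0 : (if a ≠ f ∧ c a = c f then 1 else 0) = 1 :=
          if_pos ⟨fun h => ha (h ▸ hf), hfa.symm⟩
        refine h0.symm.le.trans ?_
        exact Finset.single_le_sum (f := fun f => if a ≠ f ∧ c a = c f then 1 else 0)
          (fun _ _ => Nat.zero_le _) (Finset.mem_insert_of_mem hf)
      omega
    · rw [Finset.card_insert_of_notMem h]
      omega

/-- Collision indicator. -/
noncomputable def collInd {V : Type*} (G : SimpleGraph V) (c : Sym2 V → ℕ) (u v w x : V) : ℕ :=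
  if G.Adj u w ∧ G.Adj v x ∧ u ≠ v ∧ w ≠ x ∧ c s(u, w) = c s(v, x) then 1 else 0

/-- Non-edge indicator. -/
noncomputable def missInd {V : Type*} (G : SimpleGraph V) (u w : V) : ℕ :=
  if G.Adj u w then 0 else 1

lemma aux_pair {V : Type*} [Fintype V] [DecidableEq V] (G : SimpleGraph V) (c : Sym2 V → ℕ)
    (hc : IsProperEdgeColoring G c) (A B : Finset V) :
    A.card * B.card ≤ colorsBetween G c A B +
      ((∑ u ∈ A, ∑ w ∈ B, missInd G u w) +
        ∑ u ∈ A, ∑ v ∈ A, ∑ w ∈ B, ∑ x ∈ B, collInd G c u v w x) := by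
  set S := (A ×ˢ B).filter fun p => G.Adj p.1 p.2 with hS
  have h1 : A.card * B.card = S.card + ∑ u ∈ A, ∑ w ∈ B, missInd G u w := by
    rw [← Finset.card_product, ← Finset.card_filter_add_card_filter_not (fun p => G.Adj p.1 p.2),
      ← Finset.sum_product' A B, Finset.card_filter (fun p : V × V => ¬ G.Adj p.1 p.2)]
    congr 1
    refine Finset.sum_congr rfl fun p _ => ?_
    by_cases h : G.Adj p.1 p.2 <;> simp [missInd, h]
  have h2 := aux_image S (fun p => c s(p.1, p.2))
  have h3 : (S.image (fun p => c s(p.1, p.2))).card = colorsBetween G c A B := by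
    rw [colorsBetween, ← Set.ncard_coe_finset]
    congr 1
    ext k
    simp only [hS, Finset.coe_image, Finset.coe_filter, Finset.mem_product, Set.mem_image,
      Set.mem_ofPred_eq]
    constructor
    · rintro ⟨⟨u, w⟩, ⟨⟨hu, hw⟩, hadj⟩, rfl⟩
      exact ⟨s(u, w), ⟨hadj, u, hu, w, hw, rfl⟩, rfl⟩
    · rintro ⟨_, ⟨hadj, u, hu, w, hw, rfl⟩, rfl⟩
      exact ⟨(u, w), ⟨⟨hu, hw⟩, hadj⟩, rfl⟩
  have h4 : ∑ e ∈ S, ∑ f ∈ S, (if e ≠ f ∧ c s(e.1, e.2) = c s(f.1, f.2) then 1 else 0) ≤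
      ∑ u ∈ A, ∑ v ∈ A, ∑ w ∈ B, ∑ x ∈ B, collInd G c u v w x := by
    have e1 : ∑ u ∈ A, ∑ v ∈ A, ∑ w ∈ B, ∑ x ∈ B, collInd G c u v w x =
        ∑ e ∈ A ×ˢ B, ∑ f ∈ A ×ˢ B, collInd G c e.1 f.1 e.2 f.2 := by
      rw [Finset.sum_product]
      refine Finset.sum_congr rfl fun u _ => ?_
      rw [Finset.sum_comm]
      refine Finset.sum_congr rfl fun w _ => ?_
      rw [Finset.sum_product]
    rw [e1]
    refine le_trans (Finset.sum_le_sum fun e he => ?_)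
      (Finset.sum_le_sum_of_subset (Finset.filter_subset _ _))
    refine le_trans (Finset.sum_le_sum fun f hf => ?_)
      (Finset.sum_le_sum_of_subset (Finset.filter_subset _ _))
    obtain ⟨u, w⟩ := e
    obtain ⟨v, x⟩ := f
    simp only [hS, Finset.mem_filter, Finset.mem_product] at he hf
    split_ifs with h
    · obtain ⟨hne, hcol⟩ := h
      have huv : u ≠ v := by
        rintro rfl
        have hwx : w ≠ x := fun h => hne (by rw [h])
        refine hc (e₁ := s(u, w)) (e₂ := s(u, x)) he.2 hf.2 ?_ ⟨u, by simp, by simp⟩ hcol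
        intro h
        exact hwx (Sym2.congr_right.1 h)
      have hwx : w ≠ x := by
        rintro rfl
        refine hc (e₁ := s(u, w)) (e₂ := s(v, w)) he.2 hf.2 ?_ ⟨w, by simp, by simp⟩ hcol
        intro h
        exact huv (Sym2.congr_left.1 h)
      simp only [collInd]
      rw [if_pos ⟨he.2, hf.2, huv, hwx, hcol⟩]
    · exact Nat.zero_le _
  omega

lemma aux_coll {V : Type*} [DecidableEq V] (G : SimpleGraph V) (c : Sym2 V → ℕ)
    (hc : IsProperEdgeColoring G c) (B : Finset V) (u v : V) :
    ∑ w ∈ B, ∑ x ∈ B, collInd G c u v w x ≤ B.card := by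
  rw [Finset.card_eq_sum_ones]
  refine Finset.sum_le_sum fun w _ => ?_
  simp only [collInd]
  have hcard : ∑ x ∈ B, (if G.Adj u w ∧ G.Adj v x ∧ u ≠ v ∧ w ≠ x ∧ c s(u, w) = c s(v, x)
      then 1 else 0) = (B.filter fun x => G.Adj u w ∧ G.Adj v x ∧ u ≠ v ∧ w ≠ x ∧
        c s(u, w) = c s(v, x)).card := by
    rw [Finset.card_filter]
  refine le_trans (le_of_eq ?_) (Finset.card_le_one.2 ?_ : (B.filter fun x => G.Adj u w ∧
    G.Adj v x ∧ u ≠ v ∧ w ≠ x ∧ c s(u, w) = c s(v, x)).card ≤ 1)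
  · rw [← hcard]
    refine Finset.sum_congr rfl fun x _ => ?_
    congr
  intro x hx x' hx'
  simp only [Finset.mem_filter] at hx hx'
  by_contra hne
  refine hc (e₁ := s(v, x)) (e₂ := s(v, x')) hx.2.2.1 hx'.2.2.1 ?_ ⟨v, by simp, by simp⟩
    (hx.2.2.2.2.2.symm.trans hx'.2.2.2.2.2)
  intro h
  exact hne (Sym2.congr_right.1 h)

lemma aux_miss {n : ℕ} (G : SimpleGraph (Fin n)) (B : Finset (Fin n)) (u : Fin n) :
    ∑ w ∈ B, missInd G u w + (G.neighborSet u).ncard ≤ n := by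
  have h1 : ∑ w ∈ B, missInd G u w ≤ ∑ w, missInd G u w :=
    Finset.sum_le_sum_of_subset (Finset.subset_univ _)
  have h2 : (G.neighborSet u).ncard = ∑ w : Fin n, if G.Adj u w then 1 else 0 := by
    rw [Finset.sum_boole, Nat.cast_id, ← Set.ncard_coe_finset]
    congr 1
    ext w
    simp
  have h3 : ∑ w : Fin n, missInd G u w + (∑ w : Fin n, if G.Adj u w then 1 else 0) = n := by
    rw [← Finset.sum_add_distrib]
    have : ∀ w : Fin n, missInd G u w + (if G.Adj u w then 1 else 0) = 1 := by
      intro w; by_cases h : G.Adj u w <;> simp [missInd, h]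
    simp [this]
  omega

/-- For every sufficiently small `ε > 0` there is a constant `C` such that, when `n` is
sufficiently large, the following holds.  Let `G` be a properly edge-colored graph on `n`
vertices with minimum degree at least `(1 - δ)n` for some `δ > 0`, and let `A`, `B` be
disjoint vertex sets of sizes `a ≤ b`.  If `y` divides both `a` and `b`,
`b ≥ max{C y², C δ n}` and `y ≥ C`, then there are partitions of `A` and of `B` into parts
of size `y` such that all but at most `ε a b / y²` of the pairs of parts are
`ε`-nearly-rainbow. -/
theorem partition_into_nearly_rainbow_pairs :
    ∃ ε₀ : ℝ, 0 < ε₀ ∧ ∀ ε : ℝ, 0 < ε → ε ≤ ε₀ → ∃ C : ℝ, ∃ N : ℕ, ∀ n : ℕ, N ≤ n →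
      ∀ (G : SimpleGraph (Fin n)) (c : Sym2 (Fin n) → ℕ) (δ : ℝ)
        (A B : Finset (Fin n)) (a b y : ℕ),
        IsProperEdgeColoring G c → 0 < δ →
        (∀ v, (1 - δ) * n ≤ ((G.neighborSet v).ncard : ℝ)) →
        Disjoint A B → A.card = a → B.card = b → a ≤ b →
        y ∣ a → y ∣ b →
        max (C * (y : ℝ) ^ 2) (C * δ * n) ≤ (b : ℝ) → (C : ℝ) ≤ (y : ℝ) →
        ∃ 𝒜 ℬ : Finset (Finset (Fin n)),
          (∀ s ∈ 𝒜, s ⊆ A ∧ s.card = y) ∧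
          (𝒜 : Set (Finset (Fin n))).PairwiseDisjoint id ∧ 𝒜.biUnion id = A ∧
          (∀ s ∈ ℬ, s ⊆ B ∧ s.card = y) ∧
          (ℬ : Set (Finset (Fin n))).PairwiseDisjoint id ∧ ℬ.biUnion id = B ∧
          (((𝒜 ×ˢ ℬ).filter fun q => ¬ NearlyRainbow ε G c q.1 q.2).card : ℝ) ≤
            ε * a * b / (y : ℝ) ^ 2 := by
  refine ⟨1, one_pos, ?_⟩
  intro ε hε hε1
  refine ⟨2 / ε ^ 2, 0, ?_⟩
  intro n _ G c δ A B a b y hc hδ hdeg hAB hA hB hab hya hyb hmax hCy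
  set C : ℝ := 2 / ε ^ 2 with hC
  have hC2 : 2 ≤ C := by
    rw [hC, le_div_iff₀ (by positivity)]
    nlinarith
  have hCpos : 0 < C := by linarith
  have hCε : C * ε ^ 2 = 2 := by rw [hC]; field_simp
  have hb1 : C * (y : ℝ) ^ 2 ≤ b := (le_max_left _ _).trans hmax
  have hb2 : C * δ * n ≤ b := (le_max_right _ _).trans hmax
  have hy2 : 2 ≤ y := by exact_mod_cast hC2.trans hCy
  have hyR : (2 : ℝ) ≤ y := by exact_mod_cast hy2
  have hbpos : 0 < b := by
    have : (0 : ℝ) < b := by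
      have : 0 < C * (y : ℝ) ^ 2 := by positivity
      linarith
    exact_mod_cast this
  have hyleb : y ≤ b := Nat.le_of_dvd hbpos hyb
  obtain ⟨𝒜, hA1, hA2, hA3, -⟩ := aux_partition A y (by omega) (by rwa [hA])
    (fun _ _ => 0) (fun _ => rfl)
  obtain ⟨ℬ, hB1, hB2, hB3, hB4⟩ := aux_partition B y (by omega) (by rwa [hB])
    (fun w x => ∑ s ∈ 𝒜, ∑ u ∈ s, ∑ v ∈ s, collInd G c u v w x)
    (fun w => by simp [collInd])
  refine ⟨𝒜, ℬ, hA1, hA2, hA3, hB1, hB2, hB3, ?_⟩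
  -- total number of collisions
  set T : ℕ := ∑ s ∈ 𝒜, ∑ t ∈ ℬ, ∑ u ∈ s, ∑ v ∈ s, ∑ w ∈ t, ∑ x ∈ t, collInd G c u v w x with hT
  set M : ℕ := ∑ s ∈ 𝒜, ∑ t ∈ ℬ, ∑ u ∈ s, ∑ w ∈ t, missInd G u w with hM
  have hswap : ∀ (R Q : Finset (Fin n)),
      ∑ w ∈ R, ∑ x ∈ Q, ∑ s ∈ 𝒜, ∑ u ∈ s, ∑ v ∈ s, collInd G c u v w x =
      ∑ s ∈ 𝒜, ∑ u ∈ s, ∑ v ∈ s, ∑ w ∈ R, ∑ x ∈ Q, collInd G c u v w x := by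
    intro R Q
    rw [← Finset.sum_product' R Q, Finset.sum_comm]
    refine Finset.sum_congr rfl fun s _ => ?_
    rw [Finset.sum_comm]
    refine Finset.sum_congr rfl fun u _ => ?_
    rw [Finset.sum_comm]
    refine Finset.sum_congr rfl fun v _ => ?_
    rw [← Finset.sum_product' R Q]
  have hsumA : ∀ f : Fin n → ℕ, ∑ s ∈ 𝒜, ∑ u ∈ s, f u = ∑ u ∈ A, f u := by
    intro f
    rw [← hA3, Finset.sum_biUnion hA2]; rfl
  have hsumB : ∀ f : Fin n → ℕ, ∑ s ∈ ℬ, ∑ u ∈ s, f u = ∑ u ∈ B, f u := by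
    intro f
    rw [← hB3, Finset.sum_biUnion hB2]; rfl
  have hTle : T ≤ a * y ^ 2 := by
    have h1 : ∑ t ∈ ℬ, ∑ w ∈ t, ∑ x ∈ t, ∑ s ∈ 𝒜, ∑ u ∈ s, ∑ v ∈ s, collInd G c u v w x = T := by
      rw [hT, Finset.sum_comm]
      exact Finset.sum_congr rfl fun t _ => hswap t t
    have h2 : ∑ w ∈ B, ∑ x ∈ B, ∑ s ∈ 𝒜, ∑ u ∈ s, ∑ v ∈ s, collInd G c u v w x ≤
        a * (y * b) := by
      rw [hswap B B]
      calc _ ≤ ∑ s ∈ 𝒜, ∑ u ∈ s, y * b := by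
            refine Finset.sum_le_sum fun s hs => Finset.sum_le_sum fun u _ => ?_
            rw [← (hA1 s hs).2, ← hB]
            refine (Finset.sum_le_card_nsmul s _ B.card fun v _ => ?_).trans (by simp)
            exact aux_coll G c hc B u v
        _ = a * (y * b) := by
            rw [hsumA]; simp [hA]
    rw [h1, hB] at hB4
    have h3 : (b - 1) * T ≤ (y - 1) * (a * (y * b)) := hB4.trans (Nat.mul_le_mul_left _ h2)
    have h4 : (y - 1) * b ≤ (b - 1) * y := by
      obtain ⟨b', rfl⟩ : ∃ b', b = b' + 1 := ⟨b - 1, by omega⟩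
      obtain ⟨y', rfl⟩ : ∃ y', y = y' + 1 := ⟨y - 1, by omega⟩
      simp only [Nat.add_sub_cancel]
      nlinarith
    have h5 : (b - 1) * T ≤ (b - 1) * (a * y ^ 2) := by
      calc _ ≤ (y - 1) * (a * (y * b)) := h3
        _ = (a * y) * ((y - 1) * b) := by ring
        _ ≤ (a * y) * ((b - 1) * y) := Nat.mul_le_mul_left _ h4
        _ = _ := by ring
    exact Nat.le_of_mul_le_mul_left h5 (by omega)
  have hMle : C * (M : ℝ) ≤ a * b := by
    have h1 : M = ∑ u ∈ A, ∑ w ∈ B, missInd G u w := by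
      rw [hM, ← hsumA]
      refine Finset.sum_congr rfl fun s _ => ?_
      rw [Finset.sum_comm]
      exact Finset.sum_congr rfl fun u _ => hsumB _
    have h2 : (M : ℝ) ≤ a * (δ * n) := by
      rw [h1]
      push_cast
      rw [← hA, ← nsmul_eq_mul]
      refine Finset.sum_le_card_nsmul _ _ _ fun u _ => ?_
      have h3 := aux_miss G B u
      have h4 : ((∑ w ∈ B, missInd G u w : ℕ) : ℝ) + ((G.neighborSet u).ncard : ℝ) ≤ n := by
        exact_mod_cast h3
      have h5 := hdeg u
      push_cast at h4
      linarith
    have ha0 : (0 : ℝ) ≤ a := Nat.cast_nonneg _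
    nlinarith
  set Bad := (𝒜 ×ˢ ℬ).filter fun q => ¬ NearlyRainbow ε G c q.1 q.2 with hBad
  have hcount : (Bad.card : ℝ) * (ε * y ^ 2) ≤ M + T := by
    have h1 : ((M + T : ℕ) : ℝ) = ∑ q ∈ 𝒜 ×ˢ ℬ,
        (((∑ u ∈ q.1, ∑ w ∈ q.2, missInd G u w) +
        ∑ u ∈ q.1, ∑ v ∈ q.1, ∑ w ∈ q.2, ∑ x ∈ q.2, collInd G c u v w x : ℕ) : ℝ) := by
      rw [← Nat.cast_sum, Finset.sum_add_distrib, Finset.sum_product, Finset.sum_product]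
    rw [← Nat.cast_add, h1, ← nsmul_eq_mul]
    refine le_trans ?_ (Finset.sum_le_sum_of_subset_of_nonneg
      (Finset.filter_subset (fun q => ¬ NearlyRainbow ε G c q.1 q.2) _)
      (fun _ _ _ => Nat.cast_nonneg _))
    refine Finset.card_nsmul_le_sum _ _ _ fun q hq => ?_
    rw [Finset.mem_filter, Finset.mem_product] at hq
    obtain ⟨⟨hq1, hq2⟩, hq3⟩ := hq
    have h2 := aux_pair G c hc q.1 q.2
    rw [NearlyRainbow, not_le] at hq3
    rw [(hA1 _ hq1).2, (hB1 _ hq2).2] at h2 hq3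
    have h3 : ((y * y : ℕ) : ℝ) ≤ _ := Nat.cast_le.2 h2
    rw [Nat.cast_add (colorsBetween G c q.1 q.2), Nat.cast_mul] at h3
    linarith
  have hTR : (T : ℝ) ≤ a * y ^ 2 := by exact_mod_cast hTle
  have ha0 : (0 : ℝ) ≤ a := Nat.cast_nonneg _
  have hfin : C * ((Bad.card : ℝ) * (ε * y ^ 2)) ≤ 2 * (a * b) := by
    have := mul_le_mul_of_nonneg_left hcount hCpos.le
    have h6 := mul_le_mul_of_nonneg_left hTR hCpos.le
    have h7 := mul_le_mul_of_nonneg_left hb1 ha0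
    linarith
  rw [le_div_iff₀ (by positivity)]
  have h8 := mul_le_mul_of_nonneg_left hfin hε.le
  have h9 : ε * (C * ((Bad.card : ℝ) * (ε * y ^ 2))) = 2 * (Bad.card * y ^ 2) := by
    rw [← hCε]; ring
  rw [h9] at h8
  linarith
end

section
/- Let 0 < a ≤ b ≤ n/4, let r > 0, and let G, H_1, H_2, H_3 be edge-disjoint spanning subgraphs of the complete graph on n vertices whose edges are edge-colored by pairwise disjoint sets of colors, such that H_1, H_2 and H_3 are each (a,b)-expanders. Suppose P = {P_1, ..., P_r} is a rainbow path forest in G, let U = V(G) \ V(P), and suppose |U| ≤ b. If |P_1| ≤ n - a - |U|, then there exist edges e_j ∈ E(H_j) for j ∈ {1,2,3} and an index i ∈ {1,...,r} such that there are two vertex-disjoint paths P_1' and P_i' in the graph induced on V(P_1) ∪ V(P_i) ∪ U together with the additional edges {e_1, e_2, e_3}, satisfying: (1) P_i' is a subpath of P_i on fewer than |P_i|/2 vertices (possibly the empty path); (2) |P_1'| ≥ |P_1| + |P_i| - |P_i'|; and (3) replacing P_1 and P_i in P by P_1' and P_i' yields a rainbow path forest. -/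
open scoped Classical

/-- The list of edges of a path given by its list of vertices. -/
def listEdges {V : Type*} (l : List V) : List (Sym2 V) :=
  (l.zip l.tail).map fun q => s(q.1, q.2)

/-- `l` is (the vertex list of) a path in `G`: consecutive vertices are adjacent and no
vertex repeats.  The empty list is the path without vertices. -/
def IsPathIn {V : Type*} (G : SimpleGraph V) (l : List V) : Prop :=
  l.Chain' G.Adj ∧ l.Nodup

/-- A family of vertex lists is a rainbow path forest in `G` (w.r.t. the coloring `c`) if
each list is a path in `G`, the paths are pairwise vertex-disjoint, and all their edges
receive pairwise distinct colors. -/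
def IsRainbowPathForest {V : Type*} {r : ℕ} (G : SimpleGraph V) (c : Sym2 V → ℕ)
    (P : Fin r → List V) : Prop :=
  (∀ i, IsPathIn G (P i)) ∧
  (∀ i j, i ≠ j → ∀ v, v ∈ P i → v ∉ P j) ∧
  (((List.ofFn P).flatMap listEdges).map c).Nodup

/-- `H` is an `(a,b)`-expander: (E1) minimum degree at least `a`; (E2) every vertex set of
size at least `a` has neighborhood of size at least `n - a - b`; (E3) between any two
disjoint vertex sets of sizes `a` and `b` there is an edge. -/
def IsExpander {V : Type*} [Fintype V] (H : SimpleGraph V) (a b : ℕ) : Prop :=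
  (∀ v, a ≤ (H.neighborSet v).ncard) ∧
  (∀ A : Finset V, a ≤ A.card →
    (Fintype.card V : ℝ) - a - b ≤ ((⋃ u ∈ (A : Set V), H.neighborSet u).ncard : ℝ)) ∧
  (∀ A B : Finset V, Disjoint A B → A.card = a → B.card = b →
    ∃ u ∈ A, ∃ v ∈ B, H.Adj u v)

namespace PB

variable {V : Type*}

theorem mem_listEdges (l : List V) (e : Sym2 V) :
    e ∈ listEdges l ↔ ∃ y w, [y, w] <:+: l ∧ e = s(y, w) := by
  induction l with
  | nil => simp [listEdges]
  | cons x l ih =>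
    cases l with
    | nil =>
      simp only [listEdges, List.tail_cons, List.zip_nil_right, List.map_nil, List.not_mem_nil,
        false_iff]
      rintro ⟨y, w, h, -⟩
      have := h.length_le
      simp at this
    | cons z l =>
      have h1 : listEdges (x :: z :: l) = s(x, z) :: listEdges (z :: l) := by simp [listEdges]
      rw [h1, List.mem_cons, ih]
      constructor
      · rintro (rfl | ⟨y, w, h, rfl⟩)
        · exact ⟨x, z, ⟨[], l, by simp⟩, rfl⟩
        · exact ⟨y, w, h.trans ⟨[x], [], by simp⟩, rfl⟩
      · rintro ⟨y, w, h, rfl⟩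
        rw [List.infix_cons_iff] at h
        rcases h with h | h
        · left
          obtain ⟨t, ht⟩ := h
          simp at ht
          rw [ht.1, ht.2.1]
        · exact Or.inr ⟨y, w, h, rfl⟩

theorem listEdges_infix {l l' : List V} (h : l <:+: l') {e : Sym2 V} (he : e ∈ listEdges l) :
    e ∈ listEdges l' := by
  rw [mem_listEdges] at he ⊢
  obtain ⟨y, w, h1, h2⟩ := he
  exact ⟨y, w, h1.trans h, h2⟩

theorem listEdges_reverse (l : List V) (e : Sym2 V) :
    e ∈ listEdges l.reverse ↔ e ∈ listEdges l := by
  have key : ∀ l : List V, e ∈ listEdges l.reverse → e ∈ listEdges l := by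
    intro l h
    rw [mem_listEdges] at h ⊢
    obtain ⟨y, w, h1, h2⟩ := h
    refine ⟨w, y, ?_, by rw [h2, Sym2.eq_swap]⟩
    rw [← List.reverse_infix]
    simpa using h1
  exact ⟨key l, fun h => key _ (by simpa using h)⟩

theorem mem_of_listEdges {l : List V} {e : Sym2 V} (h : e ∈ listEdges l) {v : V} (hv : v ∈ e) :
    v ∈ l := by
  rw [mem_listEdges] at h
  obtain ⟨y, w, h1, rfl⟩ := h
  apply h1.subset
  simpa using hv

theorem listEdges_append (l t : List V) (x w : V) :
    listEdges (l ++ x :: w :: t) = listEdges (l ++ [x]) ++ s(x, w) :: listEdges (w :: t) := by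
  induction l with
  | nil => simp [listEdges]
  | cons y l ih =>
    cases l with
    | nil => simp [listEdges]
    | cons z l =>
      simp [listEdges] at ih ⊢
      exact ih

theorem nodup_listEdges {l : List V} (h : l.Nodup) : (listEdges l).Nodup := by
  induction l with
  | nil => simp [listEdges]
  | cons x l ih =>
    cases l with
    | nil => simp [listEdges]
    | cons z l =>
      have h1 : listEdges (x :: z :: l) = s(x, z) :: listEdges (z :: l) := by simp [listEdges]
      rw [h1, List.nodup_cons]
      rw [List.nodup_cons] at h
      refine ⟨fun hm => h.1 (mem_of_listEdges hm (by simp)), ih h.2⟩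

theorem chain_iff (G : SimpleGraph V) (l : List V) :
    l.IsChain G.Adj ↔ ∀ e ∈ listEdges l, e ∈ G.edgeSet := by
  induction l with
  | nil => simp [listEdges]
  | cons x l ih =>
    cases l with
    | nil => simp [listEdges]
    | cons z l =>
      have h1 : listEdges (x :: z :: l) = s(x, z) :: listEdges (z :: l) := by simp [listEdges]
      rw [h1, List.forall_mem_cons, ← ih]
      simp

theorem not_isDiag {l : List V} (h : l.Nodup) {e : Sym2 V} (he : e ∈ listEdges l) :
    ¬ e.IsDiag := by
  rw [mem_listEdges] at he
  obtain ⟨y, w, h1, rfl⟩ := he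
  have := h1.sublist.nodup h
  simp at this
  simpa using this

theorem forest_of {r : ℕ} (G : SimpleGraph V) (c : Sym2 V → ℕ) (Q : Fin r → List V)
    (S : Set (Sym2 V)) (hS : S ⊆ G.edgeSet) (hc : Set.InjOn c S)
    (hn : ∀ i, (Q i).Nodup) (hd : ∀ i j, i ≠ j → ∀ v, v ∈ Q i → v ∉ Q j)
    (he : ∀ i, ∀ e ∈ listEdges (Q i), e ∈ S) : IsRainbowPathForest G c Q := by
  refine ⟨fun i => ⟨(chain_iff _ _).2 fun e h => hS (he i e h), hn i⟩, hd, ?_⟩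
  apply List.Nodup.map_on
  · intro x hx y hy hxy
    simp only [List.mem_flatMap, List.mem_ofFn] at hx hy
    obtain ⟨_, ⟨i, rfl⟩, hx⟩ := hx
    obtain ⟨_, ⟨j, rfl⟩, hy⟩ := hy
    exact hc (he i x hx) (he j y hy) hxy
  · rw [List.nodup_flatMap]
    constructor
    · intro l hl
      simp only [List.mem_ofFn] at hl
      obtain ⟨i, rfl⟩ := hl
      exact nodup_listEdges (hn i)
    · rw [List.pairwise_ofFn]
      intro i j hij e h1 h2
      induction e with
      | _ x y =>
        exact hd i j hij.ne x (mem_of_listEdges h1 (by simp)) (mem_of_listEdges h2 (by simp))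

open Classical in
theorem exists_succ (l : List V) (h : l.Nodup) :
    ∃ g : V → V, ∀ y w, [y, w] <:+: l → g y = w := by
  refine ⟨fun y => l.getD (l.idxOf y + 1) y, ?_⟩
  rintro y w ⟨s, t, rfl⟩
  have hy : y ∉ s := by
    intro hs
    simp [List.nodup_append] at h
    exact (h.2.2 y hs).1 rfl
  simp [List.idxOf_append, hy, List.getD]

theorem exists_pred {x w : V} {l : List V} (hw : w ∈ x :: l) (hne : w ≠ x) :
    ∃ s y t, x :: l = s ++ y :: w :: t := by
  have : w ∈ l := by simpa [hne] using hw
  obtain ⟨s, t, rfl⟩ := List.append_of_mem this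
  rcases List.eq_nil_or_concat (x :: s) with h | ⟨s', y, h⟩
  · simp at h
  · refine ⟨s', y, t, ?_⟩
    rw [← List.cons_append, h]
    simp

/-- An intermediate path: it covers `p`, uses only further vertices from `U` and only
edges of `p` and of `E`. -/
def St (p : List V) (U : Finset V) (E : Set (Sym2 V)) (Q : List V) : Prop :=
  Q.Nodup ∧ (∀ v ∈ Q, v ∈ p ∨ v ∈ U) ∧ p ⊆ Q ∧ ∀ e ∈ listEdges Q, e ∈ listEdges p ∨ e ∈ E

theorem St.rot {p : List V} {U : Finset V} {E : Set (Sym2 V)} {x y w : V} {Q s t : List V}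
    (h : St p U E (x :: Q)) (hQ : x :: Q = s ++ y :: w :: t) :
    St p U (insert s(x, w) E) (y :: (s.reverse ++ w :: t)) := by
  obtain ⟨h1, h2, h3, h4⟩ := h
  have hperm : (y :: (s.reverse ++ w :: t)).Perm (x :: Q) := by
    rw [hQ]
    refine List.Perm.trans ?_ (List.perm_middle.symm)
    exact ((List.reverse_perm s).append_right _).cons y
  refine ⟨hperm.nodup_iff.2 h1, fun v hv => h2 v (hperm.subset hv),
    fun v hv => hperm.symm.subset (h3 hv), ?_⟩
  intro e he
  have hs : s ++ [y] <:+: x :: Q := by rw [hQ]; exact ⟨[], w :: t, by simp⟩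
  have ht : w :: t <:+: x :: Q := by rw [hQ]; exact ⟨s ++ [y], [], by simp⟩
  have key : ∃ m, y :: s.reverse = m ++ [x] := by
    cases s with
    | nil => simp at hQ; exact ⟨[], by simp [hQ.1]⟩
    | cons a s => simp at hQ; exact ⟨y :: s.reverse, by simp [hQ.1]⟩
  obtain ⟨m, hm⟩ := key
  have e1 : y :: (s.reverse ++ w :: t) = m ++ x :: w :: t := by
    rw [← List.cons_append, hm]; simp
  rw [e1, listEdges_append, ← hm] at he
  rw [List.mem_append, List.mem_cons] at he
  have conv : ∀ e, (e ∈ listEdges p ∨ e ∈ E) → (e ∈ listEdges p ∨ e ∈ insert s(x, w) E) := by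
    intro e h; rcases h with h | h
    · exact Or.inl h
    · exact Or.inr (Or.inr h)
  rcases he with he | he | he
  · have : y :: s.reverse = (s ++ [y]).reverse := by simp
    rw [this, listEdges_reverse] at he
    exact conv _ (h4 _ (listEdges_infix hs he))
  · exact Or.inr (Or.inl he)
  · exact conv _ (h4 _ (listEdges_infix ht he))

theorem St.ext {p : List V} {U : Finset V} {E : Set (Sym2 V)} {x u : V} {Q : List V}
    (h : St p U E (x :: Q)) (hu : u ∈ U) (hn : u ∉ x :: Q) :
    St p U (insert s(x, u) E) (u :: x :: Q) := by
  obtain ⟨h1, h2, h3, h4⟩ := h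
  refine ⟨List.nodup_cons.2 ⟨hn, h1⟩, ?_, fun v hv => List.mem_cons_of_mem _ (h3 hv), ?_⟩
  · intro v hv
    rcases List.mem_cons.1 hv with rfl | hv
    · exact Or.inr hu
    · exact h2 v hv
  · intro e he
    have h5 : listEdges (u :: x :: Q) = s(u, x) :: listEdges (x :: Q) := by simp [listEdges]
    rw [h5, List.mem_cons] at he
    rcases he with rfl | he
    · exact Or.inr (Or.inl Sym2.eq_swap)
    · rcases h4 e he with h | h
      · exact Or.inl h
      · exact Or.inr (Or.inr h)

/-- Splitting a path at `w` and attaching the longer part to `x :: Q`. -/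
theorem attach {p q : List V} {U : Finset V} {E : Set (Sym2 V)} {x w : V} {Q : List V}
    (h : St p U E (x :: Q)) (hq : q.Nodup) (hd : ∀ v ∈ q, v ∉ p ∧ v ∉ U) (hw : w ∈ q) :
    ∃ P' q' : List V, (∀ v ∈ P', v ∉ q') ∧ P'.Nodup ∧ q' <:+: q ∧
      2 * q'.length < q.length ∧ (x :: Q).length + q.length ≤ P'.length + q'.length ∧
      (∀ v ∈ P', v ∈ p ∨ v ∈ q ∨ v ∈ U) ∧
      (∀ e ∈ listEdges P', e ∈ listEdges p ∨ e ∈ listEdges q ∨ e ∈ insert s(w, x) E) := by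
  obtain ⟨h1, h2, h3, h4⟩ := h
  obtain ⟨s, t, rfl⟩ := List.append_of_mem hw
  have hdis : ∀ v ∈ s ++ w :: t, v ∉ x :: Q := by
    intro v hv hvQ
    rcases h2 v hvQ with h | h
    · exact (hd v hv).1 h
    · exact (hd v hv).2 h
  -- general statement
  have gen : ∀ m q' : List V, (m ++ [w] ++ q').Perm (s ++ w :: t) →
      q' <:+: s ++ w :: t → q'.length ≤ m.length →
      (∀ e ∈ listEdges (m ++ [w]), e ∈ listEdges (s ++ w :: t)) →
      ∃ P' q' : List V, (∀ v ∈ P', v ∉ q') ∧ P'.Nodup ∧ q' <:+: (s ++ w :: t) ∧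
      2 * q'.length < (s ++ w :: t).length ∧
      (x :: Q).length + (s ++ w :: t).length ≤ P'.length + q'.length ∧
      (∀ v ∈ P', v ∈ p ∨ v ∈ (s ++ w :: t) ∨ v ∈ U) ∧
      (∀ e ∈ listEdges P', e ∈ listEdges p ∨ e ∈ listEdges (s ++ w :: t) ∨
        e ∈ insert s(w, x) E) := by
    intro m q' hp hi hl he
    have hnd := hp.nodup_iff.2 hq
    have hlen := hp.length_eq
    have hmem : ∀ v ∈ m ++ [w], v ∈ s ++ w :: t := fun v hv =>
      hp.subset (List.mem_append_left _ hv)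
    rw [List.nodup_append'] at hnd
    have hPe : (m ++ w :: x :: Q) = (m ++ [w]) ++ (x :: Q) := by simp
    refine ⟨m ++ w :: x :: Q, q', ?_, ?_, hi, ?_, ?_, ?_, ?_⟩
    · intro v hv hv'
      rw [hPe, List.mem_append] at hv
      rcases hv with hv | hv
      · exact hnd.2.2 hv hv'
      · exact hdis v (hi.subset hv') hv
    · rw [hPe, List.nodup_append']
      exact ⟨hnd.1, h1, fun v hv hv' => hdis v (hmem v hv) hv'⟩
    · rw [← hlen]; simp; omega
    · rw [← hlen]; simp; omega
    · intro v hv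
      rw [hPe, List.mem_append] at hv
      rcases hv with hv | hv
      · exact Or.inr (Or.inl (hmem v hv))
      · rcases h2 v hv with h | h
        · exact Or.inl h
        · exact Or.inr (Or.inr h)
    · intro e hee
      rw [listEdges_append, List.mem_append, List.mem_cons] at hee
      rcases hee with hee | hee | hee
      · exact Or.inr (Or.inl (he e hee))
      · exact Or.inr (Or.inr (Or.inl hee))
      · rcases h4 e hee with h | h
        · exact Or.inl h
        · exact Or.inr (Or.inr (Or.inr h))
  rcases le_total s.length t.length with hst | hst
  · refine gen t.reverse s ?_ ⟨[], w :: t, by simp⟩ (by simpa using hst) ?_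
    · refine List.Perm.trans List.perm_append_comm ?_
      refine List.Perm.append_left s ?_
      have : t.reverse ++ [w] = (w :: t).reverse := by simp
      rw [this]
      exact List.reverse_perm _
    · intro e he
      have : t.reverse ++ [w] = (w :: t).reverse := by simp
      rw [this, listEdges_reverse] at he
      exact listEdges_infix ⟨s, [], by simp⟩ he
  · refine gen s t (by simp) ⟨s ++ [w], [], by simp⟩ hst ?_
    intro e he
    exact listEdges_infix ⟨[], t, by simp⟩ he

end PB

open PB

/-- Lemma (path builder).  Let `0 < a ≤ b ≤ n/4`, `r > 0`, and let
`F 0 = G, F 1 = H₁, F 2 = H₂, F 3 = H₃` be edge-disjoint spanning subgraphs of the complete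
graph on `n` vertices whose edges are colored by pairwise disjoint sets of colors, with
`H₁, H₂, H₃` each `(a,b)`-expanders.  Let `P = {P_1, …, P_r}` be a rainbow path forest in
`G`, let `U` be the set of vertices not covered by `P`, and suppose `|U| ≤ b` and
`|P_1| ≤ n - a - |U|`.  Then there are edges `e_j ∈ E(H_j)` and an index `i` such that in
the graph induced in `G` on `V(P_1) ∪ V(P_i) ∪ U` together with the extra edges
`{e₁, e₂, e₃}` there are two vertex-disjoint paths `P₁'`, `P_i'` with: `P_i'` a subpath of
`P_i` on fewer than `|P_i|/2` vertices (possibly empty), `|P₁'| ≥ |P_1| + |P_i| - |P_i'|`,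
and replacing `P_1`, `P_i` by `P₁'`, `P_i'` yields a rainbow path forest. -/
theorem path_builder (n r a b : ℕ) (hr : 0 < r) (ha : 0 < a) (hab : a ≤ b)
    (hbn : (b : ℝ) ≤ (n : ℝ) / 4)
    (F : Fin 4 → SimpleGraph (Fin n)) (c : Sym2 (Fin n) → ℕ)
    (hedge : ∀ i j, i ≠ j → Disjoint (F i).edgeSet (F j).edgeSet)
    (hcol : ∀ i j, i ≠ j → Disjoint (c '' (F i).edgeSet) (c '' (F j).edgeSet))
    (hexp : ∀ i, i ≠ (0 : Fin 4) → IsExpander (F i) a b)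
    (P : Fin r → List (Fin n))
    (hforest : IsRainbowPathForest (F 0) c P)
    (U : Finset (Fin n)) (hUdef : U = Finset.univ.filter fun v => ∀ i, v ∉ P i)
    (hU : U.card ≤ b)
    (hP1 : ((P ⟨0, hr⟩).length : ℝ) ≤ (n : ℝ) - a - U.card) :
    ∃ e₁ ∈ (F 1).edgeSet, ∃ e₂ ∈ (F 2).edgeSet, ∃ e₃ ∈ (F 3).edgeSet,
    ∃ (i : Fin r) (P₁' Pi' : List (Fin n)),
      (∀ v, v ∈ P₁' → v ∉ Pi') ∧
      IsPathIn (SimpleGraph.fromEdgeSet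
        ((F 0).edgeSet ∩ {e | ∀ v ∈ e, v ∈ P ⟨0, hr⟩ ∨ v ∈ P i ∨ v ∈ U} ∪ {e₁, e₂, e₃}))
        P₁' ∧
      IsPathIn (SimpleGraph.fromEdgeSet
        ((F 0).edgeSet ∩ {e | ∀ v ∈ e, v ∈ P ⟨0, hr⟩ ∨ v ∈ P i ∨ v ∈ U} ∪ {e₁, e₂, e₃}))
        Pi' ∧
      Pi' <:+: P i ∧
      ((Pi'.length : ℝ) < ((P i).length : ℝ) / 2) ∧
      (((P ⟨0, hr⟩).length : ℝ) + ((P i).length : ℝ) - (Pi'.length : ℝ) ≤ (P₁'.length : ℝ)) ∧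
      IsRainbowPathForest (F 0 ⊔ F 1 ⊔ F 2 ⊔ F 3) c
        (fun j => if j = ⟨0, hr⟩ then P₁' else if j = i then Pi' else P j) := by
  obtain ⟨hpath, hdisj, hrain⟩ := hforest
  have hold : ∀ i, ∀ e ∈ listEdges (P i), e ∈ (F 0).edgeSet := fun i =>
    (chain_iff _ _).1 (hpath i).1
  have hcol' : ∀ i j e f, e ∈ (F i).edgeSet → f ∈ (F j).edgeSet → c e = c f → i = j := by
    intro i j e f he hf hef
    by_contra hij
    exact Set.disjoint_left.1 (hcol i j hij) ⟨e, he, rfl⟩ ⟨f, hf, hef.symm⟩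
  have hUmem : ∀ v, v ∈ U ↔ ∀ i, v ∉ P i := by intro v; rw [hUdef]; simp
  by_contra hcon
  have assemble : ∀ e₁ ∈ (F 1).edgeSet, ∀ e₂ ∈ (F 2).edgeSet, ∀ e₃ ∈ (F 3).edgeSet,
      ∀ i : Fin r, i ≠ ⟨0, hr⟩ → ∀ P' q' : List (Fin n), (∀ v ∈ P', v ∉ q') → P'.Nodup →
      q' <:+: P i → 2 * q'.length < (P i).length →
      (P ⟨0, hr⟩).length + (P i).length ≤ P'.length + q'.length →
      (∀ v ∈ P', v ∈ P ⟨0, hr⟩ ∨ v ∈ P i ∨ v ∈ U) →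
      (∀ e ∈ listEdges P', e ∈ listEdges (P ⟨0, hr⟩) ∨ e ∈ listEdges (P i) ∨
        e ∈ ({e₁, e₂, e₃} : Set (Sym2 (Fin n)))) → False := by
    intro e₁ he₁ e₂ he₂ e₃ he₃ i hi P' q' hd hn hinf hl1 hl2 hv he
    have hqn : q'.Nodup := hinf.sublist.nodup (hpath i).2
    apply hcon
    refine ⟨e₁, he₁, e₂, he₂, e₃, he₃, i, P', q', hd, ⟨(chain_iff _ _).2 ?_, hn⟩,
      ⟨(chain_iff _ _).2 ?_, hqn⟩, hinf, ?_, ?_, ?_⟩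
    · intro e hee
      rw [SimpleGraph.edgeSet_fromEdgeSet]
      refine ⟨?_, not_isDiag hn hee⟩
      rcases he e hee with h | h | h
      · exact Or.inl ⟨hold _ e h, fun v hv => Or.inl (mem_of_listEdges h hv)⟩
      · exact Or.inl ⟨hold _ e h, fun v hv => Or.inr (Or.inl (mem_of_listEdges h hv))⟩
      · exact Or.inr h
    · intro e hee
      rw [SimpleGraph.edgeSet_fromEdgeSet]
      refine ⟨?_, not_isDiag hqn hee⟩
      have h := listEdges_infix hinf hee
      exact Or.inl ⟨hold _ e h, fun v hv => Or.inr (Or.inl (mem_of_listEdges h hv))⟩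
    · rw [lt_div_iff₀ (by norm_num)]
      have : q'.length * 2 < (P i).length := by omega
      exact_mod_cast this
    · rw [sub_le_iff_le_add]
      exact_mod_cast hl2
    · apply forest_of _ _ _ ({e | ∃ j, e ∈ listEdges (P j)} ∪ {e₁, e₂, e₃})
      · rintro e (⟨j, hj⟩ | rfl | rfl | rfl)
        · have := hold j e hj
          simp [SimpleGraph.edgeSet_sup, this]
        · simp [SimpleGraph.edgeSet_sup, he₁]
        · simp [SimpleGraph.edgeSet_sup, he₂]
        · simp [SimpleGraph.edgeSet_sup, he₃]
      · have tag : ∀ e ∈ ({e | ∃ j, e ∈ listEdges (P j)} ∪ {e₁, e₂, e₃} : Set (Sym2 (Fin n))),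
            ∃ k : Fin 4, e ∈ (F k).edgeSet ∧ (k = 0 → ∃ j, e ∈ listEdges (P j)) ∧
              (k = 1 → e = e₁) ∧ (k = 2 → e = e₂) ∧ (k = 3 → e = e₃) := by
          rintro e (⟨j, hj⟩ | rfl | rfl | rfl)
          · exact ⟨0, hold j e hj, fun _ => ⟨j, hj⟩, by simp, by simp, by simp⟩
          · exact ⟨1, he₁, by simp, by simp, by simp, by simp⟩
          · exact ⟨2, he₂, by simp, by simp, by simp, by simp⟩
          · exact ⟨3, he₃, by simp, by simp, by simp, by simp⟩
        intro e hee f hf hef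
        obtain ⟨k, hk, k0, k1, k2, k3⟩ := tag e hee
        obtain ⟨m, hm, m0, m1, m2, m3⟩ := tag f hf
        obtain rfl := hcol' k m e f hk hm hef
        have hk4 : k = 0 ∨ k = 1 ∨ k = 2 ∨ k = 3 := by
          clear * -
          revert k
          decide
        rcases hk4 with h | h | h | h
        · obtain ⟨j, hj⟩ := k0 h
          obtain ⟨j', hj'⟩ := m0 h
          refine List.inj_on_of_nodup_map hrain ?_ ?_ hef
          · simp only [List.mem_flatMap, List.mem_ofFn]
            exact ⟨_, ⟨j, rfl⟩, hj⟩
          · simp only [List.mem_flatMap, List.mem_ofFn]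
            exact ⟨_, ⟨j', rfl⟩, hj'⟩
        · rw [k1 h, m1 h]
        · rw [k2 h, m2 h]
        · rw [k3 h, m3 h]
      · intro j
        try dsimp only
        split_ifs
        · exact hn
        · exact hqn
        · exact (hpath j).2
      · -- disjointness
        have hPj : ∀ j, j ≠ ⟨0, hr⟩ → j ≠ i → ∀ v ∈ P', v ∉ P j := by
          intro j hj0 hji v hv' hvj
          rcases hv v hv' with h | h | h
          · exact hdisj _ _ hj0 v hvj h
          · exact hdisj _ _ hji v hvj h
          · exact (hUmem v).1 h j hvj
        have hqj : ∀ j, j ≠ i → ∀ v ∈ q', v ∉ P j := by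
          intro j hji v hv' hvj
          exact hdisj _ _ hji v hvj (hinf.subset hv')
        intro j k hjk v
        try dsimp only
        by_cases hj0 : j = ⟨0, hr⟩
        · have hk0 : k ≠ ⟨0, hr⟩ := fun h => hjk (hj0.trans h.symm)
          rw [if_pos hj0, if_neg hk0]
          by_cases hki : k = i
          · rw [if_pos hki]; exact hd v
          · rw [if_neg hki]; exact hPj k hk0 hki v
        · rw [if_neg hj0]
          by_cases hji : j = i
          · have hki : k ≠ i := fun h => hjk (hji.trans h.symm)
            rw [if_pos hji]
            by_cases hk0 : k = ⟨0, hr⟩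
            · rw [if_pos hk0]; exact fun h h' => hd v h' h
            · rw [if_neg hk0, if_neg hki]; exact hqj k hki v
          · rw [if_neg hji]
            by_cases hk0 : k = ⟨0, hr⟩
            · rw [if_pos hk0]; exact fun h h' => hPj j hj0 hji v h' h
            · rw [if_neg hk0]
              by_cases hki : k = i
              · rw [if_pos hki]; exact fun h h' => hqj j hji v h' h
              · rw [if_neg hki]; exact hdisj j k hjk v
      · intro j e
        try dsimp only
        split_ifs with h h'
        · intro hee
          rcases he e hee with h | h | h
          · exact Or.inl ⟨_, h⟩
          · exact Or.inl ⟨_, h⟩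
          · exact Or.inr h
        · intro hee
          exact Or.inl ⟨_, listEdges_infix hinf hee⟩
        · intro hee
          exact Or.inl ⟨_, hee⟩
  clear hcon
  -- arithmetic in ℕ
  have hbn' : 4 * b ≤ n := by
    have : (4 * b : ℝ) ≤ n := by linarith
    exact_mod_cast this
  have hP1' : (P ⟨0, hr⟩).length + a + U.card ≤ n := by
    have : ((P ⟨0, hr⟩).length + a + U.card : ℝ) ≤ n := by linarith
    exact_mod_cast this
  -- the remaining vertices
  obtain ⟨W, hW⟩ : ∃ W : Finset (Fin n), W = (((P ⟨0, hr⟩).toFinset ∪ U)ᶜ) := ⟨_, rfl⟩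
  have hWmem : ∀ v, v ∈ W ↔ v ∉ P ⟨0, hr⟩ ∧ v ∉ U := by intro v; simp [hW]
  have hWcard : a ≤ W.card := by
    rw [hW, Finset.card_compl, Fintype.card_fin]
    have h1 := Finset.card_union_le (P ⟨0, hr⟩).toFinset U
    have h2 := List.toFinset_card_le (P ⟨0, hr⟩)
    omega
  have hWi : ∀ w ∈ W, ∃ i, i ≠ ⟨0, hr⟩ ∧ w ∈ P i := by
    intro w hw
    rw [hWmem, hUmem] at hw
    obtain ⟨h1, h2⟩ := hw
    push Not at h2
    obtain ⟨i, hi⟩ := h2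
    refine ⟨i, ?_, hi⟩
    rintro rfl
    exact h1 hi
  -- neighbours
  have hnb : ∀ k : Fin 4, k ≠ 0 → ∀ v, ∃ w, (F k).Adj v w := by
    intro k hk v
    have := (hexp k hk).1 v
    have h2 : ((F k).neighborSet v).Nonempty := by
      rw [← Set.ncard_pos (Set.toFinite _)]; omega
    exact h2
  obtain ⟨v0⟩ : Nonempty (Fin n) := ⟨⟨0, by omega⟩⟩
  have hed : ∀ k : Fin 4, k ≠ 0 → ∃ e, e ∈ (F k).edgeSet := by
    intro k hk
    obtain ⟨w, hw⟩ := hnb k hk v0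
    exact ⟨s(v0, w), hw⟩
  obtain ⟨d2, hd2⟩ := hed 2 (by decide)
  obtain ⟨d3, hd3⟩ := hed 3 (by decide)
  have finish : ∀ e₁ ∈ (F 1).edgeSet, ∀ e₂ ∈ (F 2).edgeSet, ∀ e₃ ∈ (F 3).edgeSet,
      ∀ (E : Set (Sym2 (Fin n))) (x : Fin n) (Q : List (Fin n)), St (P ⟨0, hr⟩) U E (x :: Q) →
      ∀ w ∈ W, insert s(w, x) E ⊆ ({e₁, e₂, e₃} : Set (Sym2 (Fin n))) → False := by
    intro e₁ he₁ e₂ he₂ e₃ he₃ E x Q hQ w hw hE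
    obtain ⟨i, hi, hwi⟩ := hWi w hw
    obtain ⟨P', q', h1, h2, h3, h4, h5, h6, h7⟩ := attach hQ (hpath i).2
      (fun v hv => ⟨hdisj i _ hi v hv, fun h => (hUmem v).1 h i hv⟩) hwi
    refine assemble e₁ he₁ e₂ he₂ e₃ he₃ i hi P' q' h1 h2 h3 h4 ?_ h6 ?_
    · have : (P ⟨0, hr⟩).length ≤ (x :: Q).length :=
        ((hpath ⟨0, hr⟩).2.subperm hQ.2.2.1).length_le
      omega
    · intro e he
      rcases h7 e he with h | h | h
      · exact Or.inl h
      · exact Or.inr (Or.inl h)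
      · exact Or.inr (Or.inr (hE h))
  have hpn := (hpath ⟨0, hr⟩).2
  have hpold := hold ⟨0, hr⟩
  have hpU : ∀ v ∈ P ⟨0, hr⟩, v ∉ U := fun v hv h => (hUmem v).1 h _ hv
  have hpnil : P ⟨0, hr⟩ ≠ [] := by
    intro hnil
    obtain ⟨w, hw⟩ : W.Nonempty := Finset.card_pos.1 (by omega)
    obtain ⟨i, hi, hwi⟩ := hWi w hw
    obtain ⟨d1, hd1⟩ := hed 1 (by decide)
    have hlen : 0 < (P i).length := List.length_pos_of_mem hwi
    refine assemble d1 hd1 d2 hd2 d3 hd3 i hi (P i) [] (by simp) (hpath i).2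
      ⟨[], P i, by simp⟩ (by simpa using hlen) (by simp [hnil])
      (fun v hv => Or.inr (Or.inl hv)) (fun e he => Or.inr (Or.inl he))
  generalize P ⟨0, hr⟩ = p at *
  clear hP1 hP1' assemble hdisj hrain hpath hold hWi hUdef hUmem hW hcol hcol' hed
  obtain ⟨x, p', rfl⟩ : ∃ x p', p = x :: p' := List.exists_cons_of_ne_nil hpnil
  clear hpnil
  obtain ⟨gs, hgs⟩ := exists_succ _ hpn
  obtain ⟨gp, hgp⟩ := exists_succ _ (List.nodup_reverse.2 hpn)
  have hgp' : ∀ y w, [y, w] <:+: x :: p' → gp w = y := by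
    intro y w h
    apply hgp
    rw [← List.reverse_infix]
    simpa using h
  let g1 : Fin n → Fin n := fun z => if z ∈ U then z else gs z
  let g2 : Fin n → Fin n := fun z => if z ∈ U then x else gp z
  have hcov : ∀ v, v ∈ W ∨ v ∈ x :: p' ∨ v ∈ U := by
    intro v; rw [hWmem]; tauto
  have hst0 : St (x :: p') U ∅ (x :: p') :=
    ⟨hpn, fun v hv => Or.inl hv, fun v hv => hv, fun e he => Or.inl he⟩
  -- first step
  let A1 : Finset (Fin n) := Finset.univ.filter fun z =>
    ∃ w, (F 1).Adj x w ∧ ((∃ s t, x :: p' = s ++ z :: w :: t) ∨ (w ∈ U ∧ z = w))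
  have hA1 : a ≤ A1.card := by
    have h1 : (F 1).neighborSet x ⊆ (A1.image g1 : Finset (Fin n)) := by
      intro w hw
      rw [SimpleGraph.mem_neighborSet] at hw
      rw [Finset.mem_coe, Finset.mem_image]
      rcases hcov w with h | h | h
      · exfalso
        refine finish s(x, w) hw d2 hd2 d3 hd3 _ _ _ hst0 w h ?_
        rintro e (rfl | h)
        · exact Or.inl Sym2.eq_swap
        · exact absurd h (by simp)
      · obtain ⟨s, y, t, hy⟩ := exists_pred h hw.ne'
        refine ⟨y, by simp only [A1, Finset.mem_filter, Finset.mem_univ, true_and]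
                      exact ⟨w, hw, Or.inl ⟨s, t, hy⟩⟩, ?_⟩
        have hyU : y ∉ U := hpU y (by rw [hy]; simp)
        simp only [g1, if_neg hyU]
        exact hgs y w ⟨s, t, by rw [hy]; simp⟩
      · refine ⟨w, by simp only [A1, Finset.mem_filter, Finset.mem_univ, true_and]
                      exact ⟨w, hw, Or.inr ⟨h, rfl⟩⟩, ?_⟩
        simp only [g1, if_pos h]
    have h2 := Set.ncard_le_ncard h1 (Set.toFinite _)
    rw [Set.ncard_coe_finset] at h2
    have h3 := (hexp 1 (by decide)).1 x
    exact h3.trans (h2.trans Finset.card_image_le)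
  -- second step
  let A2 : Finset (Fin n) := Finset.univ.filter fun z =>
    ∃ e₁ ∈ (F 1).edgeSet, ∃ e₂ ∈ (F 2).edgeSet, ∃ Q, St (x :: p') U {e₂, e₁} (z :: Q)
  have step : ∀ z ∈ A1, ∀ w, (F 2).Adj z w → ∃ y ∈ A2, g1 y = w ∨ g2 y = w := by
    intro z hz w hw
    simp only [A1, Finset.mem_filter, Finset.mem_univ, true_and] at hz
    obtain ⟨w1, hw1, hz⟩ := hz
    have mem2 : ∀ y Q, St (x :: p') U {s(z, w), s(x, w1)} (y :: Q) → y ∈ A2 := by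
      intro y Q hQ
      simp only [A2, Finset.mem_filter, Finset.mem_univ, true_and]
      exact ⟨s(x, w1), hw1, s(z, w), hw, Q, hQ⟩
    have early : ∀ Q, St (x :: p') U {s(x, w1)} (z :: Q) → w ∉ W := by
      intro Q hQ h
      refine finish s(x, w1) hw1 s(z, w) hw d3 hd3 _ _ _ hQ w h ?_
      rintro e (rfl | rfl)
      · exact Or.inr (Or.inl Sym2.eq_swap)
      · exact Or.inl rfl
    have gS : ∀ y, [y, w] <:+: x :: p' → g1 y = w := by
      intro y h
      have hyU : y ∉ U := hpU y (h.subset (by simp))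
      simp only [g1, if_neg hyU]
      exact hgs y w h
    have gP : ∀ y, [w, y] <:+: x :: p' → g2 y = w := by
      intro y h
      have hyU : y ∉ U := hpU y (h.subset (by simp))
      simp only [g2, if_neg hyU]
      exact hgp' w y h
    rcases hz with ⟨s, t, hst⟩ | ⟨hzU, rfl⟩
    · have hQ := hst0.rot hst
      rw [insert_empty_eq] at hQ
      rcases hcov w with h | h | h
      · exact absurd h (early _ hQ)
      · rw [hst] at h
        have hww1 : w ≠ w1 := by
          rintro rfl
          have hwE : s(z, w) ∈ (F 2).edgeSet := hw
          refine Set.disjoint_left.1 (hedge 0 2 (by decide)) (hpold _ ?_) hwE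
          rw [mem_listEdges]
          exact ⟨z, w, ⟨s, t, by rw [hst]; simp⟩, rfl⟩
        have h' : w ∈ s ∨ w ∈ t := by
          simp only [List.mem_append, List.mem_cons] at h
          have := hw.ne'
          tauto
        rcases h' with h' | h'
        · obtain ⟨s1, s2, rfl⟩ := List.append_of_mem h'
          rcases List.eq_nil_or_concat (z :: s2.reverse) with hn | ⟨m, y, hm⟩
          · simp at hn
          · have hr : s2 ++ [z] = y :: m.reverse := by
              have := congrArg List.reverse hm
              simpa using this
            refine ⟨y, mem2 y _ (hQ.rot (s := m) (y := y) (w := w)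
              (t := s1.reverse ++ w1 :: t) ?_), Or.inr (gP y ⟨s1, m.reverse ++ w1 :: t, ?_⟩)⟩
            · have : z :: ((s1 ++ w :: s2).reverse ++ w1 :: t) =
                (z :: s2.reverse) ++ w :: (s1.reverse ++ w1 :: t) := by simp
              rw [this, hm]
              simp
            · rw [hst]
              have : s1 ++ w :: s2 ++ z :: w1 :: t = s1 ++ w :: ((s2 ++ [z]) ++ w1 :: t) := by
                simp
              rw [this, hr]
              simp
        · obtain ⟨t1, t2, rfl⟩ := List.append_of_mem h'
          rcases List.eq_nil_or_concat (w1 :: t1) with hn | ⟨m, y, hm⟩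
          · simp at hn
          · refine ⟨y, mem2 y _ (hQ.rot (s := z :: (s.reverse ++ m)) (y := y) (w := w)
              (t := t2) ?_), Or.inl (gS y ⟨s ++ z :: m, t2, ?_⟩)⟩
            · have e2 : w1 :: (t1 ++ w :: t2) = m ++ y :: w :: t2 := by
                rw [← List.cons_append, hm]
                simp
              rw [e2]
              simp
            · have e2 : w1 :: (t1 ++ w :: t2) = m ++ y :: w :: t2 := by
                rw [← List.cons_append, hm]
                simp
              rw [hst, e2]
              simp
      · refine ⟨w, mem2 w _ (hQ.ext h ?_), Or.inl (by simp only [g1, if_pos h])⟩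
        intro hmem
        refine hpU w ?_ h
        rw [hst]
        simp only [List.mem_append, List.mem_cons, List.mem_reverse] at hmem ⊢
        tauto
    · have hQ := hst0.ext hzU (fun h => hpU z h hzU)
      rw [insert_empty_eq] at hQ
      rcases hcov w with h | h | h
      · exact absurd h (early _ hQ)
      · by_cases hwx : w = x
        · subst hwx
          exact ⟨z, mem2 z _ (hQ.rot (s := []) (y := z) (w := w) (t := p') (by simp)),
            Or.inr (by simp only [g2, if_pos hzU])⟩
        · obtain ⟨s, y, t, hy⟩ := exists_pred h hwx
          exact ⟨y, mem2 y _ (hQ.rot (s := z :: s) (y := y) (w := w) (t := t) (by simp [hy])),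
            Or.inl (gS y ⟨s, t, by rw [hy]; simp⟩)⟩
      · refine ⟨w, mem2 w _ (hQ.ext h ?_), Or.inl (by simp only [g1, if_pos h])⟩
        intro hmem
        rcases List.mem_cons.1 hmem with h1 | h1
        · exact hw.ne' h1
        · exact hpU w h1 h
  have hA2 : b ≤ A2.card := by
    have h1 : (⋃ u ∈ (A1 : Set (Fin n)), (F 2).neighborSet u) ⊆
        ((A2.image g1 ∪ A2.image g2 : Finset (Fin n)) : Set (Fin n)) := by
      intro w hw
      simp only [Set.mem_iUnion] at hw
      obtain ⟨z, hz, hzw⟩ := hw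
      obtain ⟨y, hy, h⟩ := step z hz w hzw
      rw [Finset.mem_coe, Finset.mem_union, Finset.mem_image, Finset.mem_image]
      rcases h with h | h
      · exact Or.inl ⟨y, hy, h⟩
      · exact Or.inr ⟨y, hy, h⟩
    have h2 := Set.ncard_le_ncard h1 (Set.toFinite _)
    rw [Set.ncard_coe_finset] at h2
    have h3 := (hexp 2 (by decide)).2.1 A1 hA1
    rw [Fintype.card_fin] at h3
    have h4 := Finset.card_union_le (A2.image g1) (A2.image g2)
    have h5 : (A2.image g1).card ≤ A2.card := Finset.card_image_le
    have h6 : (A2.image g2).card ≤ A2.card := Finset.card_image_le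
    have h7 : (n : ℝ) ≤ ((⋃ u ∈ (A1 : Set (Fin n)), (F 2).neighborSet u).ncard : ℝ) + a + b := by
      linarith
    have h8 : n ≤ (⋃ u ∈ (A1 : Set (Fin n)), (F 2).neighborSet u).ncard + a + b := by
      exact_mod_cast h7
    omega
  -- third step
  obtain ⟨B, hB, hBc⟩ := Finset.exists_subset_card_eq hA2
  obtain ⟨A, hA, hAc⟩ := Finset.exists_subset_card_eq hWcard
  have hAB : Disjoint A B := by
    rw [Finset.disjoint_left]
    intro v hvA hvB
    have h1 := (hWmem v).1 (hA hvA)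
    have h2 := hB hvB
    simp only [A2, Finset.mem_filter, Finset.mem_univ, true_and] at h2
    obtain ⟨_, _, _, _, Q, hQ⟩ := h2
    have := hQ.2.1 v (by simp)
    tauto
  obtain ⟨w, hwA, z, hzB, hwz⟩ := (hexp 3 (by decide)).2.2 A B hAB hAc hBc
  have h2 := hB hzB
  simp only [A2, Finset.mem_filter, Finset.mem_univ, true_and] at h2
  obtain ⟨e₁, he₁, e₂, he₂, Q, hQ⟩ := h2
  refine finish e₁ he₁ e₂ he₂ s(w, z) hwz _ _ _ hQ w (hA hwA) ?_
  rintro e (rfl | rfl | rfl)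
  · exact Or.inr (Or.inr rfl)
  · exact Or.inr (Or.inl rfl)
  · exact Or.inl rfl
end

section
/- There exists a constant C such that for every n and every δ = δ(n) > 0 the following holds: if G is a properly edge-colored graph on n vertices with minimum degree δ(G) ≥ (1 - δ)n, then G contains a spanning rainbow path forest with at most C(log n)^2 + 3δn paths. -/
open scoped Classical

set_option linter.unusedSectionVars false

namespace RPF

section States

variable {V : Type} [Fintype V] [DecidableEq V] {k : ℕ}

/-- multiset of colours on a path -/
def colM (c : Sym2 V → ℕ) (l : List V) : Multiset ℕ := ((listEdges l).map c : List ℕ)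

/-- multiset of vertices of a path -/
def verM (l : List V) : Multiset V := (l : Multiset V)

/-- a labelled spanning rainbow path forest -/
structure Valid (G : SimpleGraph V) (c : Sym2 V → ℕ) (P : Fin k → List V) : Prop where
  ne : ∀ i, P i ≠ []
  chain : ∀ i, (P i).IsChain G.Adj
  ver : ∑ i, verM (P i) = (Finset.univ : Finset V).val
  col : (∑ i, colM c (P i)).Nodup

lemma listEdges_cons_cons (x y : V) (l : List V) :
    listEdges (x :: y :: l) = s(x, y) :: listEdges (y :: l) := by
  simp [listEdges]

lemma colM_split (c : Sym2 V → ℕ) (l₁ l₂ : List V) (p q : V) :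
    colM c (l₁ ++ p :: q :: l₂) = colM c (l₁ ++ [p]) + {c s(p, q)} + colM c (q :: l₂) := by
  induction l₁ with
  | nil => simp [colM, listEdges, Multiset.singleton_add, ← Multiset.cons_coe]
  | cons x l ih =>
    cases l with
    | nil =>
      simp only [colM, List.cons_append, List.nil_append, listEdges_cons_cons] at ih ⊢
      simp only [List.map_cons, ← Multiset.cons_coe] at ih ⊢
      simp [listEdges, ← Multiset.singleton_add, add_assoc]
    | cons y l =>
      simp only [colM, List.cons_append, listEdges_cons_cons] at ih ⊢
      simp only [List.map_cons, ← Multiset.cons_coe, Multiset.cons_add] at ih ⊢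
      rw [ih]

lemma colM_single (c : Sym2 V → ℕ) (p : V) : colM c [p] = 0 := by
  simp [colM, listEdges]

lemma colM_reverse (c : Sym2 V → ℕ) (l : List V) : colM c l.reverse = colM c l := by
  induction l with
  | nil => rfl
  | cons x l ih =>
    cases l with
    | nil => rfl
    | cons y l =>
      have h1 := colM_split c [] l x y
      have h2 := colM_split c l.reverse [] y x
      simp only [List.reverse_cons, List.append_assoc, List.cons_append, List.nil_append] at h1 h2 ih ⊢
      rw [h2, h1, ih, colM_single, Sym2.eq_swap]
      abel

lemma verM_append (l₁ l₂ : List V) : verM (l₁ ++ l₂) = verM l₁ + verM l₂ := by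
  simp [verM]

lemma verM_cons (x : V) (l : List V) : verM (x :: l) = {x} + verM l := by
  simp [verM, Multiset.singleton_add]

lemma verM_reverse (l : List V) : verM l.reverse = verM l := by
  simp [verM]

lemma sum_upd {α : Type} (φ : List V → Multiset α) (P : Fin k → List V) (b : Fin k) (l : List V) :
    ∑ i, φ (Function.update P b l i) + φ (P b) = ∑ i, φ (P i) + φ l := by
  rw [← Finset.add_sum_erase Finset.univ _ (Finset.mem_univ b),
    ← Finset.add_sum_erase Finset.univ (fun i => φ (P i)) (Finset.mem_univ b)]
  have : ∑ x ∈ Finset.univ.erase b, φ (Function.update P b l x)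
      = ∑ x ∈ Finset.univ.erase b, φ (P x) := by
    apply Finset.sum_congr rfl
    intro x hx
    rw [Function.update_of_ne (Finset.ne_of_mem_erase hx)]
  rw [this, Function.update_self]
  abel

/-- elementary moves in the slots `J` -/
inductive Step (G : SimpleGraph V) (c : Sym2 V → ℕ) (J : Finset (Fin k)) :
    (Fin k → List V) → (Fin k → List V) → Prop
  | flip (P) (a : Fin k) (ha : a ∈ J) : Step G c J P (Function.update P a (P a).reverse)
  | cut1 (P) (a b d : Fin k) (ha : a ∈ J) (hb : b ∈ J) (hab : a ≠ b) (hda : d ≠ a) (hdb : d ≠ b)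
      (x y p q : V) (xs ys l₁ l₂ : List V) (hPa : P a = x :: xs) (hPb : P b = y :: ys)
      (hPd : P d = l₁ ++ p :: q :: l₂) (hadj : G.Adj x y) (hc : c s(x, y) = c s(p, q)) :
      Step G c J P (Function.update (Function.update (Function.update P d (l₁ ++ [p])) a (q :: l₂))
        b (xs.reverse ++ x :: y :: ys))
  | cut2 (P) (a b : Fin k) (ha : a ∈ J) (hb : b ∈ J) (hab : a ≠ b)
      (x y p q : V) (xs ys l₁ l₂ : List V) (hPa : P a = x :: xs) (hl : l₁ ++ [p] = y :: ys)
      (hPb : P b = l₁ ++ p :: q :: l₂) (hadj : G.Adj x y) (hc : c s(x, y) = c s(p, q)) :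
      Step G c J P (Function.update (Function.update P a (q :: l₂))
        b (xs.reverse ++ x :: y :: ys))

variable {G : SimpleGraph V} {c : Sym2 V → ℕ} {J J' : Finset (Fin k)} {P P' : Fin k → List V}

lemma Step.mono (hJ : J ⊆ J') (h : Step G c J P P') : Step G c J' P P' := by
  cases h with
  | flip a ha => exact Step.flip _ a (hJ ha)
  | cut1 a b d ha hb hab hda hdb x y p q xs ys l₁ l₂ hPa hPb hPd hadj hc =>
    exact Step.cut1 _ a b d (hJ ha) (hJ hb) hab hda hdb x y p q xs ys l₁ l₂ hPa hPb hPd hadj hc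
  | cut2 a b ha hb hab x y p q xs ys l₁ l₂ hPa hl hPb hadj hc =>
    exact Step.cut2 _ a b (hJ ha) (hJ hb) hab x y p q xs ys l₁ l₂ hPa hl hPb hadj hc

lemma Step.head_eq (h : Step G c J P P') {d : Fin k} (hd : d ∉ J) :
    (P' d).head? = (P d).head? := by
  cases h with
  | flip a ha =>
    rw [Function.update_of_ne]
    rintro rfl; exact hd ha
  | cut1 a b e ha hb hab hda hdb x y p q xs ys l₁ l₂ hPa hPb hPd hadj hc =>
    rw [Function.update_of_ne (by rintro rfl; exact hd hb),
      Function.update_of_ne (by rintro rfl; exact hd ha)]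
    by_cases hde : d = e
    · subst hde
      rw [Function.update_self, hPd]
      cases l₁ <;> simp
    · rw [Function.update_of_ne hde]
  | cut2 a b ha hb hab x y p q xs ys l₁ l₂ hPa hl hPb hadj hc =>
    rw [Function.update_of_ne (by rintro rfl; exact hd hb),
      Function.update_of_ne (by rintro rfl; exact hd ha)]

lemma isChain_join {x y : V} {xs ys : List V} (h1 : (x :: xs).IsChain G.Adj)
    (h2 : (y :: ys).IsChain G.Adj) (h : G.Adj x y) :
    (xs.reverse ++ x :: y :: ys).IsChain G.Adj := by
  have h3 : (xs.reverse ++ [x]).IsChain G.Adj := by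
    have := List.isChain_reverse.2 (show (x :: xs).IsChain (fun a b => G.Adj b a) by
      simpa [G.adj_comm] using h1)
    simpa using this
  have : xs.reverse ++ x :: y :: ys = (xs.reverse ++ [x]) ++ (y :: ys) := by simp
  rw [this, List.isChain_append]
  refine ⟨h3, h2, ?_⟩
  simp
  exact h

lemma isChain_left {p q : V} {l₁ l₂ : List V} (h : (l₁ ++ p :: q :: l₂).IsChain G.Adj) :
    (l₁ ++ [p]).IsChain G.Adj ∧ (q :: l₂).IsChain G.Adj := by
  have : l₁ ++ p :: q :: l₂ = (l₁ ++ [p]) ++ (q :: l₂) := by simp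
  rw [this, List.isChain_append] at h
  exact ⟨h.1, h.2.1⟩

lemma colM_join (c : Sym2 V → ℕ) (x y : V) (xs ys : List V) :
    colM c (xs.reverse ++ x :: y :: ys) = colM c (x :: xs) + {c s(x, y)} + colM c (y :: ys) := by
  rw [colM_split, ← colM_reverse c (x :: xs)]
  simp

lemma verM_join (x y : V) (xs ys : List V) :
    verM (xs.reverse ++ x :: y :: ys) = verM (x :: xs) + verM (y :: ys) := by
  rw [verM_append, verM_reverse, verM_cons, verM_cons x xs]
  abel

lemma verM_split (p q : V) (l₁ l₂ : List V) :
    verM (l₁ ++ p :: q :: l₂) = verM (l₁ ++ [p]) + verM (q :: l₂) := by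
  rw [show l₁ ++ p :: q :: l₂ = (l₁ ++ [p]) ++ (q :: l₂) by simp, verM_append]

lemma sum_upd2 {α : Type} (φ : List V → Multiset α) (P : Fin k → List V) {a b : Fin k}
    (hab : a ≠ b) (l l' : List V) (h : φ (P a) + φ (P b) = φ l + φ l') :
    ∑ i, φ (Function.update (Function.update P a l) b l' i) = ∑ i, φ (P i) := by
  have h1 := sum_upd φ P a l
  have h2 := sum_upd φ (Function.update P a l) b l'
  rw [Function.update_of_ne hab.symm] at h2
  apply add_right_cancel (b := φ (P a) + φ (P b))
  calc _ = (∑ i, φ (Function.update (Function.update P a l) b l' i) + φ (P b)) + φ (P a) := by abel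
    _ = (∑ i, φ (Function.update P a l i) + φ (P a)) + φ l' := by rw [h2]; abel
    _ = _ := by rw [h1, h]; abel

lemma sum_upd3 {α : Type} (φ : List V → Multiset α) (P : Fin k → List V) {a b d : Fin k}
    (hab : a ≠ b) (hda : d ≠ a) (hdb : d ≠ b) (m l l' : List V)
    (h : φ (P d) + φ (P a) + φ (P b) = φ m + φ l + φ l') :
    ∑ i, φ (Function.update (Function.update (Function.update P d m) a l) b l' i)
      = ∑ i, φ (P i) := by
  have h0 := sum_upd φ P d m
  have h1 := sum_upd φ (Function.update P d m) a l
  have h2 := sum_upd φ (Function.update (Function.update P d m) a l) b l'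
  rw [Function.update_of_ne hda.symm] at h1
  rw [Function.update_of_ne hab.symm, Function.update_of_ne hdb.symm] at h2
  apply add_right_cancel (b := φ (P d) + φ (P a) + φ (P b))
  rw [show ∀ S : Multiset α, S + (φ (P d) + φ (P a) + φ (P b)) = (S + φ (P b)) + φ (P a) + φ (P d)
    by intro S; abel, h2, add_right_comm _ (φ l'), h1, add_right_comm _ (φ l') (φ (P d)),
    add_right_comm _ (φ l) (φ (P d)), h0, h]
  abel

lemma Step.sums (h : Step G c J P P') :
    ∑ i, verM (P' i) = ∑ i, verM (P i) ∧ ∑ i, colM c (P' i) = ∑ i, colM c (P i) := by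
  cases h with
  | flip a ha =>
    constructor
    · have := sum_upd verM P a (P a).reverse
      rw [verM_reverse] at this
      exact add_right_cancel this
    · have := sum_upd (colM c) P a (P a).reverse
      rw [colM_reverse] at this
      exact add_right_cancel this
  | cut1 a b d ha hb hab hda hdb x y p q xs ys l₁ l₂ hPa hPb hPd hadj hc =>
    constructor
    · apply sum_upd3 _ _ hab hda hdb
      rw [hPa, hPb, hPd, verM_join, verM_split]; abel
    · apply sum_upd3 _ _ hab hda hdb
      rw [hPa, hPb, hPd, colM_join, colM_split, hc]; abel
  | cut2 a b ha hb hab x y p q xs ys l₁ l₂ hPa hl hPb hadj hc =>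
    constructor
    · apply sum_upd2 _ _ hab
      rw [hPa, hPb, verM_join, verM_split, hl]; abel
    · apply sum_upd2 _ _ hab
      rw [hPa, hPb, colM_join, colM_split, hc, hl]; abel

lemma forall_upd {α : Type*} {Q : α → Prop} {P : Fin k → α} {a : Fin k} {l : α}
    (h : ∀ i, Q (P i)) (hl : Q l) : ∀ i, Q (Function.update P a l i) := by
  intro i
  by_cases hi : i = a
  · subst hi; simpa using hl
  · rw [Function.update_of_ne hi]; exact h i

lemma Step.valid (hP : Valid G c P) (h : Step G c J P P') : Valid G c P' := by
  have hs := h.sums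
  refine ⟨?_, ?_, hs.1.trans hP.ver, hs.2 ▸ hP.col⟩
  · cases h with
    | flip a ha => exact forall_upd (Q := fun l : List V => l ≠ []) hP.ne (by simpa using hP.ne a)
    | cut1 a b d ha hb hab hda hdb x y p q xs ys l₁ l₂ hPa hPb hPd hadj hc =>
      exact forall_upd (Q := fun l : List V => l ≠ []) (forall_upd (Q := fun l : List V => l ≠ [])
        (forall_upd (Q := fun l : List V => l ≠ []) hP.ne (by simp)) (by simp)) (by simp)
    | cut2 a b ha hb hab x y p q xs ys l₁ l₂ hPa hl hPb hadj hc =>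
      exact forall_upd (Q := fun l : List V => l ≠ []) (forall_upd (Q := fun l : List V => l ≠ [])
        hP.ne (by simp)) (by simp)
  · cases h with
    | flip a ha =>
      refine forall_upd (Q := fun l : List V => l.IsChain G.Adj) hP.chain ?_
      have := List.isChain_reverse.2 (show (P a).IsChain (fun a b => G.Adj b a) by
        simpa [G.adj_comm] using hP.chain a)
      simpa using this
    | cut1 a b d ha hb hab hda hdb x y p q xs ys l₁ l₂ hPa hPb hPd hadj hc =>
      have h1 := hP.chain d
      rw [hPd] at h1
      have h2 := hP.chain a
      have h3 := hP.chain b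
      rw [hPa] at h2
      rw [hPb] at h3
      exact forall_upd (Q := fun l : List V => l.IsChain G.Adj) (forall_upd (Q := fun l : List V => l.IsChain G.Adj)
        (forall_upd (Q := fun l : List V => l.IsChain G.Adj) hP.chain (isChain_left h1).1)
        (isChain_left h1).2) (isChain_join h2 h3 hadj)
    | cut2 a b ha hb hab x y p q xs ys l₁ l₂ hPa hl hPb hadj hc =>
      have h1 := hP.chain b
      rw [hPb] at h1
      have h2 := hP.chain a
      rw [hPa] at h2
      exact forall_upd (Q := fun l : List V => l.IsChain G.Adj) (forall_upd (Q := fun l : List V => l.IsChain G.Adj)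
        hP.chain (isChain_left h1).2) (isChain_join h2 (hl ▸ (isChain_left h1).1) hadj)

end States
end RPF

namespace RPF

section Reach

variable {V : Type} [Fintype V] [DecidableEq V] {k : ℕ}

/-- sequences of moves -/
abbrev Steps (G : SimpleGraph V) (c : Sym2 V → ℕ) (J : Finset (Fin k)) :
    (Fin k → List V) → (Fin k → List V) → Prop := Relation.ReflTransGen (Step G c J)

/-- vertices which can be made the head of a slot of `J` -/
noncomputable def Reach (G : SimpleGraph V) (c : Sym2 V → ℕ) (P : Fin k → List V)
    (J : Finset (Fin k)) : Finset V :=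
  Finset.univ.filter (fun v => ∃ P', Steps G c J P P' ∧ ∃ a ∈ J, (P' a).head? = some v)

/-- colours of edges between simultaneous heads of slots of `J` -/
noncomputable def BC (G : SimpleGraph V) (c : Sym2 V → ℕ) (P : Fin k → List V)
    (J : Finset (Fin k)) : Finset ℕ :=
  ((Finset.univ : Finset (Sym2 V)).image c).filter (fun γ => ∃ P', Steps G c J P P' ∧
    ∃ a ∈ J, ∃ b ∈ J, a ≠ b ∧ ∃ x y, (P' a).head? = some x ∧ (P' b).head? = some y ∧
      G.Adj x y ∧ c s(x, y) = γ)

/-- `w` immediately follows `p` in `l` -/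
def Con (l : List V) (p w : V) : Prop := ∃ l₁ l₂, l = l₁ ++ p :: w :: l₂

variable {G : SimpleGraph V} {c : Sym2 V → ℕ} {J J' : Finset (Fin k)} {P P' : Fin k → List V}

lemma mem_Reach {v : V} : v ∈ Reach G c P J ↔
    ∃ P', Steps G c J P P' ∧ ∃ a ∈ J, (P' a).head? = some v := by
  simp [Reach]

lemma mem_BC {γ : ℕ} : γ ∈ BC G c P J ↔ ∃ P', Steps G c J P P' ∧
    ∃ a ∈ J, ∃ b ∈ J, a ≠ b ∧ ∃ x y, (P' a).head? = some x ∧ (P' b).head? = some y ∧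
      G.Adj x y ∧ c s(x, y) = γ := by
  unfold BC
  rw [Finset.mem_filter, and_iff_right_iff_imp]
  rintro ⟨_, _, _, _, _, _, _, x, y, _, _, _, rfl⟩
  exact Finset.mem_image_of_mem _ (Finset.mem_univ _)

lemma Steps.mono (hJ : J ⊆ J') (h : Steps G c J P P') : Steps G c J' P P' :=
  Relation.ReflTransGen.mono (fun _ _ (hs : Step G c J _ _) => hs.mono hJ) _ _ h

lemma Steps.valid (h : Steps G c J P P') (hP : Valid G c P) : Valid G c P' := by
  induction h with
  | refl => exact hP
  | tail _ hs ih => exact hs.valid ih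

lemma Steps.col (h : Steps G c J P P') : ∑ i, colM c (P' i) = ∑ i, colM c (P i) := by
  induction h with
  | refl => rfl
  | tail _ hs ih => exact hs.sums.2.trans ih

lemma Steps.head_eq (h : Steps G c J P P') {d : Fin k} (hd : d ∉ J) :
    (P' d).head? = (P d).head? := by
  induction h with
  | refl => rfl
  | tail _ hs ih => exact (hs.head_eq hd).trans ih

lemma Reach_mono (hJ : J ⊆ J') : Reach G c P J ⊆ Reach G c P J' := by
  intro v hv
  rw [mem_Reach] at hv ⊢
  obtain ⟨P', h, a, ha, e⟩ := hv
  exact ⟨P', Steps.mono hJ h, a, hJ ha, e⟩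

lemma Reach_steps (h : Steps G c J P P') : Reach G c P' J ⊆ Reach G c P J := by
  intro v hv
  rw [mem_Reach] at hv ⊢
  obtain ⟨P'', h', a, ha, e⟩ := hv
  exact ⟨P'', h.trans h', a, ha, e⟩

lemma BC_mono (hJ : J ⊆ J') : BC G c P J ⊆ BC G c P J' := by
  intro v hv
  rw [mem_BC] at hv ⊢
  obtain ⟨P', h, a, ha, b, hb, e⟩ := hv
  exact ⟨P', Steps.mono hJ h, a, hJ ha, b, hJ hb, e⟩

lemma BC_steps (h : Steps G c J P P') : BC G c P' J ⊆ BC G c P J := by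
  intro v hv
  rw [mem_BC] at hv ⊢
  obtain ⟨P'', h', a, ha, e⟩ := hv
  exact ⟨P'', h.trans h', a, ha, e⟩

lemma con_cons {x p w : V} {l : List V} :
    Con (x :: l) p w ↔ (x = p ∧ l.head? = some w) ∨ Con l p w := by
  constructor
  · rintro ⟨l₁, l₂, h⟩
    cases l₁ with
    | nil =>
      simp only [List.nil_append, List.cons.injEq] at h
      left; refine ⟨h.1, ?_⟩; rw [h.2]; rfl
    | cons z l₁ =>
      simp only [List.cons_append, List.cons.injEq] at h
      right; exact ⟨l₁, l₂, h.2⟩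
  · rintro (⟨rfl, h⟩ | ⟨l₁, l₂, rfl⟩)
    · cases l with
      | nil => simp at h
      | cons z l =>
        simp only [List.head?_cons, Option.some.injEq] at h
        subst h
        exact ⟨[], l, rfl⟩
    · exact ⟨x :: l₁, l₂, rfl⟩

lemma not_con_nil {p w : V} : ¬ Con ([] : List V) p w := by
  rintro ⟨l₁, l₂, h⟩
  simp at h

lemma Con.append_right {l : List V} {p w : V} (h : Con l p w) (m : List V) : Con (l ++ m) p w := by
  obtain ⟨l₁, l₂, rfl⟩ := h
  exact ⟨l₁, l₂ ++ m, by simp⟩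

lemma Con.append_left {l : List V} {p w : V} (h : Con l p w) (m : List V) : Con (m ++ l) p w := by
  obtain ⟨l₁, l₂, rfl⟩ := h
  exact ⟨m ++ l₁, l₂, by simp⟩

lemma Con.reverse {l : List V} {p w : V} (h : Con l p w) : Con l.reverse w p := by
  obtain ⟨l₁, l₂, rfl⟩ := h
  exact ⟨l₂.reverse, l₁.reverse, by simp⟩

lemma con_split {l₁ l₂ : List V} {p q u v : V} (h : Con (l₁ ++ p :: q :: l₂) u v) :
    Con (l₁ ++ [p]) u v ∨ (u = p ∧ v = q) ∨ Con (q :: l₂) u v := by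
  induction l₁ with
  | nil =>
    rw [List.nil_append, con_cons] at h
    rcases h with ⟨h1, h2⟩ | h
    · simp at h2
      exact Or.inr (Or.inl ⟨h1.symm, h2.symm⟩)
    · exact Or.inr (Or.inr h)
  | cons x l₁ ih =>
    rw [List.cons_append, con_cons] at h
    rw [List.cons_append, con_cons]
    rcases h with ⟨h1, h2⟩ | h
    · left; left
      refine ⟨h1, ?_⟩
      cases l₁ with
      | nil => simpa using h2
      | cons z l => simpa using h2
    · rcases ih h with h | h | h
      · exact Or.inl (Or.inr h)
      · exact Or.inr (Or.inl h)
      · exact Or.inr (Or.inr h)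

lemma Con.mem_right {l : List V} {p w : V} (h : Con l p w) : w ∈ l := by
  obtain ⟨l₁, l₂, rfl⟩ := h
  simp

lemma Con.mem_tail {l : List V} {p w : V} (h : Con l p w) : w ∈ l.tail := by
  obtain ⟨l₁, l₂, rfl⟩ := h
  cases l₁ <;> simp

lemma Con.unique {l : List V} {p p' w : V} (hl : l.Nodup) (h : Con l p w) (h' : Con l p' w) :
    p = p' := by
  induction l with
  | nil => exact (not_con_nil h).elim
  | cons x l ih =>
    rw [con_cons] at h h'
    rw [List.nodup_cons] at hl
    have key : l.head? = some w → ∀ q, ¬ Con l q w := by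
      intro h1 q h2
      have := h2.mem_tail
      cases l with
      | nil => simp at h1
      | cons z l =>
        simp at h1
        subst h1
        have h3 := hl.2
        rw [List.nodup_cons] at h3
        exact h3.1 this
    rcases h with ⟨h1, h2⟩ | h
    · rcases h' with ⟨h3, h4⟩ | h'
      · rw [← h1, h3]
      · exact (key h2 _ h').elim
    · rcases h' with ⟨h3, h4⟩ | h'
      · exact (key h4 _ h).elim
      · exact ih hl.2 h h'

lemma exists_con_of_mem_colM {l : List V} {γ : ℕ} (h : γ ∈ colM c l) :
    ∃ p w, Con l p w ∧ c s(p, w) = γ := by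
  induction l with
  | nil => simp [colM, listEdges] at h
  | cons x l ih =>
    cases l with
    | nil => simp [colM, listEdges] at h
    | cons y l =>
      have h1 := colM_split c [] l x y
      simp only [List.nil_append] at h1
      rw [h1, colM_single, zero_add, Multiset.mem_add, Multiset.mem_singleton] at h
      rcases h with h | h
      · exact ⟨x, y, ⟨[], l, rfl⟩, h.symm⟩
      · obtain ⟨p, w, hc, e⟩ := ih h
        exact ⟨p, w, con_cons.2 (Or.inr hc), e⟩

lemma exists_cons_of_head? {l : List V} {x : V} (h : l.head? = some x) : ∃ xs, l = x :: xs := by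
  cases l with
  | nil => simp at h
  | cons z l => simp at h; exact ⟨l, by rw [h]⟩

lemma Valid.head_exists (hP : Valid G c P) (a : Fin k) : ∃ x, (P a).head? = some x := by
  cases h : P a with
  | nil => exact (hP.ne a h).elim
  | cons x l => exact ⟨x, rfl⟩

lemma Valid.nodup_sum (hP : Valid G c P) : (∑ i, verM (P i)).Nodup := by
  rw [hP.ver]; exact Finset.univ.nodup

lemma Valid.nodup (hP : Valid G c P) (i : Fin k) : (P i).Nodup := by
  have h := hP.nodup_sum
  rw [← Finset.add_sum_erase Finset.univ _ (Finset.mem_univ i)] at h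
  have h2 := (Multiset.nodup_add.1 h).1
  exact h2

lemma Valid.disj (hP : Valid G c P) {i j : Fin k} {v : V} (hi : v ∈ P i) (hj : v ∈ P j) :
    i = j := by
  by_contra hij
  have h := hP.nodup_sum
  rw [← Finset.add_sum_erase Finset.univ _ (Finset.mem_univ i)] at h
  have h2 := (Multiset.nodup_add.1 h).2.2
  rw [Multiset.disjoint_left] at h2
  refine h2 (a := v) hi ?_
  rw [Multiset.mem_sum]
  exact ⟨j, Finset.mem_erase.2 ⟨Ne.symm hij, Finset.mem_univ _⟩, hj⟩

/-- a cut makes both ends of the deleted edge reachable -/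
lemma cut_reach {a b d : Fin k} (ha : a ∈ J) (hb : b ∈ J) (hab : a ≠ b) {x y u v : V}
    (hx : (P a).head? = some x) (hy : (P b).head? = some y) (hadj : G.Adj x y)
    (hcon : Con (P d) u v) (hc : c s(x, y) = c s(u, v)) :
    v ∈ Reach G c P J ∧ (d ∈ J → u ∈ Reach G c P J) := by
  have hcase : ∀ (a b : Fin k) (ha : a ∈ J) (hb : b ∈ J) (hab : a ≠ b) (x y : V)
      (hx : (P a).head? = some x) (hy : (P b).head? = some y) (hadj : G.Adj x y)
      (hcon : Con (P b) u v) (hc : c s(x, y) = c s(u, v)),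
      v ∈ Reach G c P J ∧ u ∈ Reach G c P J := by
    intro a b ha hb hab x y hx hy hadj hcon hc
    obtain ⟨xs, hxs⟩ := exists_cons_of_head? hx
    obtain ⟨l₁, l₂, hl⟩ := hcon
    obtain ⟨ys, hys⟩ : ∃ ys, l₁ ++ [u] = y :: ys := by
      apply exists_cons_of_head?
      rw [← hy, hl]
      cases l₁ <;> simp
    have hs := Step.cut2 (G := G) (c := c) P a b ha hb hab x y u v xs ys l₁ l₂ hxs hys hl hadj hc
    constructor
    · rw [mem_Reach]
      refine ⟨_, Relation.ReflTransGen.single hs, a, ha, ?_⟩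
      rw [Function.update_of_ne hab, Function.update_self]
      rfl
    · rw [mem_Reach]
      refine ⟨_, (Relation.ReflTransGen.single hs).tail (Step.flip _ b hb), b, hb, ?_⟩
      rw [Function.update_self, Function.update_self]
      rw [show x :: y :: ys = [x] ++ (y :: ys) from rfl, ← hys]
      simp
  by_cases hda : d = a
  · subst hda
    have := hcase b d hb ha hab.symm y x hy hx hadj.symm hcon (by rw [Sym2.eq_swap, hc])
    exact ⟨this.1, fun _ => this.2⟩
  by_cases hdb : d = b
  · subst hdb
    have := hcase a d ha hb hab x y hx hy hadj hcon hc
    exact ⟨this.1, fun _ => this.2⟩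
  obtain ⟨xs, hxs⟩ := exists_cons_of_head? hx
  obtain ⟨ys, hys⟩ := exists_cons_of_head? hy
  obtain ⟨l₁, l₂, hl⟩ := hcon
  have hs := Step.cut1 (G := G) (c := c) P a b d ha hb hab hda hdb x y u v xs ys l₁ l₂ hxs hys hl
    hadj hc
  constructor
  · rw [mem_Reach]
    refine ⟨_, Relation.ReflTransGen.single hs, a, ha, ?_⟩
    rw [Function.update_of_ne hab, Function.update_self]
    rfl
  · intro hd
    rw [mem_Reach]
    refine ⟨_, (Relation.ReflTransGen.single hs).tail (Step.flip _ d hd), d, hd, ?_⟩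
    rw [Function.update_self, Function.update_of_ne hdb, Function.update_of_ne hda,
      Function.update_self]
    simp

lemma Step.con (h : Step G c J P P') {d : Fin k} {u v : V} (hcon : Con (P d) u v) :
    (v ∈ Reach G c P J ∧ (d ∈ J → u ∈ Reach G c P J)) ∨
    ∃ e, (Con (P' e) u v ∧ (d ∈ J → e ∈ J)) ∨ (e ∈ J ∧ Con (P' e) v u) := by
  cases h with
  | flip a ha =>
    right
    by_cases hd : d = a
    · subst hd
      refine ⟨d, Or.inr ⟨ha, ?_⟩⟩
      rw [Function.update_self]; exact hcon.reverse
    · refine ⟨d, Or.inl ⟨?_, id⟩⟩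
      rw [Function.update_of_ne hd]; exact hcon
  | cut1 a b e ha hb hab hda hdb x y p q xs ys l₁ l₂ hPa hPb hPd hadj hc =>
    by_cases h1 : d = a
    · subst h1
      right
      refine ⟨b, Or.inr ⟨hb, ?_⟩⟩
      rw [Function.update_self]
      rw [hPa] at hcon
      have := hcon.reverse.append_right (y :: ys)
      simpa using this
    by_cases h2 : d = b
    · subst h2
      right
      refine ⟨d, Or.inl ⟨?_, id⟩⟩
      rw [Function.update_self]
      rw [hPb] at hcon
      have := hcon.append_left (xs.reverse ++ [x])
      simpa using this
    by_cases h3 : d = e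
    · subst h3
      have hcon0 := hcon
      rw [hPd] at hcon
      rcases con_split hcon with h | ⟨rfl, rfl⟩ | h
      · right
        refine ⟨d, Or.inl ⟨?_, id⟩⟩
        rw [Function.update_of_ne h2, Function.update_of_ne h1, Function.update_self]
        exact h
      · left
        exact cut_reach ha hb hab (by rw [hPa]; rfl) (by rw [hPb]; rfl) hadj hcon0 hc
      · right
        refine ⟨a, Or.inl ⟨?_, fun _ => ha⟩⟩
        rw [Function.update_of_ne hab, Function.update_self]
        exact h
    right
    refine ⟨d, Or.inl ⟨?_, id⟩⟩
    rw [Function.update_of_ne h2, Function.update_of_ne h1, Function.update_of_ne h3]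
    exact hcon
  | cut2 a b ha hb hab x y p q xs ys l₁ l₂ hPa hl hPb hadj hc =>
    by_cases h1 : d = a
    · subst h1
      right
      refine ⟨b, Or.inr ⟨hb, ?_⟩⟩
      rw [Function.update_self]
      rw [hPa] at hcon
      have := hcon.reverse.append_right (y :: ys)
      simpa using this
    by_cases h2 : d = b
    · subst h2
      have hcon0 := hcon
      rw [hPb] at hcon
      rcases con_split hcon with h | ⟨rfl, rfl⟩ | h
      · right
        refine ⟨d, Or.inl ⟨?_, id⟩⟩
        rw [Function.update_self]
        rw [hl] at h
        have := h.append_left (xs.reverse ++ [x])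
        simpa using this
      · left
        refine cut_reach ha hb hab (by rw [hPa]; rfl) (y := y) ?_ hadj hcon0 hc
        have := congrArg List.head? hl
        rw [hPb]
        rw [List.head?_cons] at this
        rw [← this]
        cases l₁ <;> simp
      · right
        refine ⟨a, Or.inl ⟨?_, fun _ => ha⟩⟩
        rw [Function.update_of_ne hab, Function.update_self]
        exact h
    right
    refine ⟨d, Or.inl ⟨?_, id⟩⟩
    rw [Function.update_of_ne h2, Function.update_of_ne h1]
    exact hcon

lemma Steps.con (h : Steps G c J P P') {i : Fin k} {p w : V} (hcon : Con (P i) p w) :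
    w ∈ Reach G c P J ∨ ∃ d, Con (P' d) p w ∨ (d ∈ J ∧ Con (P' d) w p) := by
  induction h with
  | refl => exact Or.inr ⟨i, Or.inl hcon⟩
  | tail h0 hs ih =>
    rcases ih with ih | ⟨d, hd | ⟨hdJ, hd⟩⟩
    · exact Or.inl ih
    · rcases hs.con hd with h | ⟨e, ⟨h, _⟩ | ⟨he, h⟩⟩
      · exact Or.inl (Reach_steps h0 h.1)
      · exact Or.inr ⟨e, Or.inl h⟩
      · exact Or.inr ⟨e, Or.inr ⟨he, h⟩⟩
    · rcases hs.con hd with h | ⟨e, ⟨h, h'⟩ | ⟨he, h⟩⟩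
      · exact Or.inl (Reach_steps h0 (h.2 hdJ))
      · exact Or.inr ⟨e, Or.inr ⟨h' hdJ, h⟩⟩
      · exact Or.inr ⟨e, Or.inl h⟩

/-- no valid forest with fewer parts -/
def Minimal (G : SimpleGraph V) (c : Sym2 V → ℕ) (k : ℕ) : Prop :=
  ∀ k' < k, ∀ P : Fin k' → List V, ¬ Valid G c P

lemma Minimal.used (hmin : Minimal G c k) (hP : Valid G c P) {a b : Fin k} (hab : a ≠ b) {x y : V}
    (hx : (P a).head? = some x) (hy : (P b).head? = some y) (hadj : G.Adj x y) :
    c s(x, y) ∈ ∑ i, colM c (P i) := by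
  by_contra hnot
  obtain ⟨xs, hxs⟩ := exists_cons_of_head? hx
  obtain ⟨ys, hys⟩ := exists_cons_of_head? hy
  cases k with
  | zero => exact a.elim0
  | succ k =>
    obtain ⟨b', hb'⟩ := Fin.exists_succAbove_eq hab.symm
    set Q : Fin k → List V := fun i => P (a.succAbove i) with hQ
    have hQb : Q b' = y :: ys := by rw [hQ]; simp only [hb', hys]
    refine hmin k (Nat.lt_succ_self k) (Function.update Q b' (xs.reverse ++ x :: y :: ys)) ?_
    have hca := hP.chain a
    have hcb := hP.chain b
    rw [hxs] at hca
    rw [hys] at hcb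
    refine ⟨?_, ?_, ?_, ?_⟩
    · exact forall_upd (Q := fun l : List V => l ≠ []) (fun i => hP.ne _) (by simp)
    · exact forall_upd (Q := fun l : List V => l.IsChain G.Adj) (fun i => hP.chain _)
        (isChain_join hca hcb hadj)
    · have h := sum_upd verM Q b' (xs.reverse ++ x :: y :: ys)
      have h2 := hP.ver
      rw [Fin.sum_univ_succAbove _ a, hxs] at h2
      rw [verM_join, hQb, ← add_assoc] at h
      have h := add_right_cancel h
      rw [h, ← h2, add_comm]
    · have h := sum_upd (colM c) Q b' (xs.reverse ++ x :: y :: ys)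
      have h2 := hP.col
      rw [Fin.sum_univ_succAbove _ a, hxs] at h2 hnot
      rw [colM_join, hQb, ← add_assoc] at h
      have h := add_right_cancel h
      rw [h, ← add_assoc, add_comm, Multiset.singleton_add, Multiset.nodup_cons]
      rw [add_comm]  at hnot h2
      exact ⟨hnot, h2⟩

/-- the key inequality -/
lemma card_BC (hmin : Minimal G c k) (hP : Valid G c P) (J : Finset (Fin k)) :
    (BC G c P J).card + J.card ≤ (Reach G c P J).card := by
  rcases J.eq_empty_or_nonempty with rfl | ⟨j0, hj0⟩
  · have : BC G c P (∅ : Finset (Fin k)) = ∅ := by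
      rw [Finset.eq_empty_iff_forall_notMem]
      intro γ hγ
      rw [mem_BC] at hγ
      obtain ⟨_, _, a, ha, _⟩ := hγ
      simp at ha
    simp [this]
  have : Nonempty (Fin k) := ⟨j0⟩
  have : Nonempty V := ⟨(hP.head_exists j0).choose⟩
  have hB : ∀ γ ∈ BC G c P J, ∃ i p w, Con (P i) p w ∧ c s(p, w) = γ ∧ w ∈ Reach G c P J := by
    intro γ hγ
    rw [mem_BC] at hγ
    obtain ⟨P', hs, a, ha, b, hb, hab, x, y, hx, hy, hadj, rfl⟩ := hγ
    have hu := hmin.used (hs.valid hP) hab hx hy hadj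
    rw [hs.col, Multiset.mem_sum] at hu
    obtain ⟨i, _, hi⟩ := hu
    obtain ⟨p, w, hcon, hc⟩ := exists_con_of_mem_colM hi
    refine ⟨i, p, w, hcon, hc, ?_⟩
    rcases hs.con hcon with h | ⟨d, h | ⟨hd, h⟩⟩
    · exact h
    · exact Reach_steps hs (cut_reach ha hb hab hx hy hadj h hc.symm).1
    · exact Reach_steps hs ((cut_reach ha hb hab hx hy hadj h (by rw [hc.symm, Sym2.eq_swap])).2 hd)
  choose! fi fp fw h1 h2 h3 using hB
  choose hd hhd using hP.head_exists
  have hdm : ∀ i, hd i ∈ P i := fun i => List.mem_of_mem_head? (hhd i)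
  have e1 : ((BC G c P J).image fw).card = (BC G c P J).card := by
    apply Finset.card_image_of_injOn
    intro γ hγ γ' hγ' he
    have c1 := h1 γ hγ
    have c2 := h1 γ' hγ'
    rw [← he] at c2
    have hi := hP.disj c1.mem_right c2.mem_right
    rw [← hi] at c2
    have hp := Con.unique (hP.nodup _) c1 c2
    rw [← h2 γ hγ, ← h2 γ' hγ', he, hp]
  have e2 : (J.image hd).card = J.card := by
    apply Finset.card_image_of_injOn
    intro i _ j _ he
    have := hdm j
    rw [← he] at this
    exact hP.disj (hdm i) this
  rw [← e1, ← e2, ← Finset.card_union_of_disjoint]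
  · apply Finset.card_le_card
    intro v hv
    rcases Finset.mem_union.1 hv with hv | hv
    · obtain ⟨γ, hγ, rfl⟩ := Finset.mem_image.1 hv
      exact h3 γ hγ
    · obtain ⟨j, hj, rfl⟩ := Finset.mem_image.1 hv
      exact mem_Reach.2 ⟨P, Relation.ReflTransGen.refl, j, hj, hhd j⟩
  · rw [Finset.disjoint_left]
    intro v hv hv'
    obtain ⟨γ, hγ, rfl⟩ := Finset.mem_image.1 hv
    obtain ⟨j, hj, he⟩ := Finset.mem_image.1 hv'
    have c1 := h1 γ hγ
    have := hdm j
    rw [he] at this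
    have hij := hP.disj c1.mem_right this
    have c2 := c1.mem_tail
    have hn := hP.nodup (fi γ)
    have hh := hhd j
    rw [he, ← hij] at hh
    obtain ⟨xs, hxs⟩ := exists_cons_of_head? hh
    rw [hxs] at c2 hn
    exact (List.nodup_cons.1 hn).1 c2

end Reach
end RPF

namespace RPF

section Count

variable {V : Type} [Fintype V] [DecidableEq V] {k : ℕ}
variable {G : SimpleGraph V} {c : Sym2 V → ℕ} {J J' : Finset (Fin k)} {P P' : Fin k → List V}

lemma proper_inj (hc : IsProperEdgeColoring G c) {v s s' : V} (h : G.Adj v s) (h' : G.Adj v s')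
    (he : c s(v, s) = c s(v, s')) : s = s' := by
  by_contra hne
  refine hc (e₁ := s(v, s)) (e₂ := s(v, s')) h h' ?_ ⟨v, by simp, by simp⟩ he
  intro h2
  rw [Sym2.eq_iff] at h2
  rcases h2 with ⟨_, h2⟩ | ⟨h2, h3⟩
  · exact hne h2
  · exact hne (h3.trans h2)

/-- every vertex has at most `D` non-neighbours -/
def Dense (G : SimpleGraph V) (D : ℕ) : Prop :=
  ∀ v, (Finset.univ.filter (fun s => ¬ G.Adj v s)).card ≤ D

lemma edge_BC {a : Fin k} (ha : a ∉ J) {v s : V} (hv : (P a).head? = some v)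
    (hs : s ∈ Reach G c P J) (hadj : G.Adj v s) : c s(v, s) ∈ BC G c P (insert a J) := by
  rw [mem_Reach] at hs
  obtain ⟨P', h, b, hb, hbs⟩ := hs
  rw [mem_BC]
  refine ⟨P', Steps.mono (Finset.subset_insert _ _) h, a, Finset.mem_insert_self _ _, b,
    Finset.mem_insert_of_mem hb, ?_, v, s, ?_, hbs, hadj, rfl⟩
  · rintro rfl; exact ha hb
  · rw [h.head_eq ha, hv]

lemma card_colours (hc : IsProperEdgeColoring G c) {D : ℕ} (hD : Dense G D) (v : V) (S : Finset V)
    (B : Finset ℕ) (h : ∀ s ∈ S, G.Adj v s → c s(v, s) ∈ B) : S.card ≤ B.card + D := by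
  have h1 : (S.filter (fun s => G.Adj v s)).card ≤ B.card := by
    apply Finset.card_le_card_of_injOn (fun s => c s(v, s))
    · intro s hs
      have hs := Finset.mem_filter.1 hs
      exact h s hs.1 hs.2
    · intro s hs s' hs' he
      exact proper_inj hc (Finset.mem_filter.1 hs).2 (Finset.mem_filter.1 hs').2 he
  have h2 : (S.filter (fun s => ¬ G.Adj v s)).card ≤ D :=
    (Finset.card_le_card (Finset.filter_subset_filter _ (Finset.subset_univ S))).trans (hD v)
  have h3 := Finset.card_filter_add_card_filter_not (s := S) (fun s => G.Adj v s)
  omega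

lemma card_BC_insert (hc : IsProperEdgeColoring G c) {D : ℕ} (hD : Dense G D)
    {a : Fin k} (ha : a ∉ J) {v : V} (hv : (P a).head? = some v) :
    (Reach G c P J).card ≤ (BC G c P (insert a J)).card + D :=
  card_colours hc hD v _ _ (fun _ hs hadj => edge_BC ha hv hs hadj)

lemma linear_gain (hmin : Minimal G c k) (hc : IsProperEdgeColoring G c) {D : ℕ} (hD : Dense G D)
    (hP : Valid G c P) {a : Fin k} (ha : a ∉ J) (hJ : D ≤ J.card) :
    (Reach G c P J).card + 1 ≤ (Reach G c P (insert a J)).card := by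
  obtain ⟨v, hv⟩ := hP.head_exists a
  have h1 := card_BC_insert hc hD ha hv
  have h2 := card_BC hmin hP (insert a J)
  rw [Finset.card_insert_of_notMem ha] at h2
  omega

lemma count (hmin : Minimal G c k) (hc : IsProperEdgeColoring G c) {D : ℕ} (hD : Dense G D)
    (hP : Valid G c P) {J Js : Finset (Fin k)} (hJ : J ⊆ Js) (hJD : D ≤ J.card) (hJ1 : 1 ≤ J.card)
    (g0 g1 : ℕ)
    (hg1 : ∀ P', Steps G c Js P P' → ∀ J' ⊆ Js, J'.card + 1 = Js.card →
      g1 ≤ (Reach G c P' J').card)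
    (hg0 : ∀ P', Steps G c Js P P' → ∀ J' ⊆ Js, J'.card + 1 = J.card →
      g0 ≤ (Reach G c P' J').card) :
    ((Reach G c P J).card : ℤ) * (g1 + g0 - 2 * (Reach G c P J).card)
      ≤ ((Reach G c P Js).card - (Reach G c P J).card) * ((Reach G c P Js).card - g0) := by
  set A := Reach G c P J with hA
  set As := Reach G c P Js with hAs
  set B := BC G c P J with hB
  set Bs := BC G c P Js with hBs
  have hAAs : A ⊆ As := Reach_mono hJ
  have hBBs : B ⊆ Bs := BC_mono hJ
  have hKB : B.card + J.card ≤ A.card := card_BC hmin hP J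
  have hKBs : Bs.card + Js.card ≤ As.card := card_BC hmin hP Js
  have hJJs := Finset.card_le_card hJ
  have hex : ∀ v ∈ A, ∃ (P' : Fin k → List V) (a : Fin k), Steps G c J P P' ∧ a ∈ J ∧
      (P' a).head? = some v := by
    intro v hv
    obtain ⟨P', h, a, ha, e⟩ := mem_Reach.1 hv
    exact ⟨P', a, h, ha, e⟩
  -- sizes of the sets around a vertex
  have hT : ∀ v ∈ A, ((g1 : ℤ) + g0 - 2 * A.card) ≤ (((As \ A).filter (fun s => G.Adj v s ∧
      c s(v, s) ∈ Bs \ B)).card : ℤ) ∧ g0 ≤ B.card + D := by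
    intro v hv
    obtain ⟨P', a, h, ha, e⟩ := hex v hv
    have hs' : Steps G c Js P P' := Steps.mono hJ h
    set X := Reach G c P' (Js.erase a) with hX
    set Y := Reach G c P' (J.erase a) with hY
    have hXc : g1 ≤ X.card := hg1 P' hs' _ (Finset.erase_subset _ _)
      (Finset.card_erase_add_one (hJ ha))
    have hYc : g0 ≤ Y.card := hg0 P' hs' _ ((Finset.erase_subset _ _).trans hJ)
      (Finset.card_erase_add_one ha)
    have hXAs : X ⊆ As := (Reach_mono (Finset.erase_subset _ _)).trans (Reach_steps hs')
    have hYA : Y ⊆ A := (Reach_mono (Finset.erase_subset _ _)).trans (Reach_steps h)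
    have hXB : ∀ s ∈ X, G.Adj v s → c s(v, s) ∈ Bs := by
      intro s hs hadj
      have := edge_BC (Finset.notMem_erase a Js) e hs hadj
      rw [Finset.insert_erase (hJ ha)] at this
      exact BC_steps hs' this
    have hYB : ∀ s ∈ Y, G.Adj v s → c s(v, s) ∈ B := by
      intro s hs hadj
      have := edge_BC (Finset.notMem_erase a J) e hs hadj
      rw [Finset.insert_erase ha] at this
      exact BC_steps h this
    refine ⟨?_, hYc.trans (card_colours hc hD v Y B hYB)⟩
    set T := (As \ A).filter (fun s => G.Adj v s ∧ c s(v, s) ∈ Bs \ B) with hTdef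
    set Z := X.filter (fun s => s ∉ T ∧ s ∉ A \ Y) with hZ
    have hZc : Z.card ≤ B.card + D := by
      apply card_colours hc hD v
      intro s hs hadj
      obtain ⟨hsX, hsT, hsA⟩ := Finset.mem_filter.1 hs
      by_contra hB'
      apply hsT
      rw [hTdef, Finset.mem_filter]
      refine ⟨Finset.mem_sdiff.2 ⟨hXAs hsX, ?_⟩, hadj, Finset.mem_sdiff.2 ⟨hXB s hsX hadj, hB'⟩⟩
      intro hsA'
      apply hsA
      rw [Finset.mem_sdiff]
      exact ⟨hsA', fun hsY => hB' (hYB s hsY hadj)⟩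
    have hcov : X ⊆ T ∪ (A \ Y) ∪ Z := by
      intro s hs
      by_cases h1 : s ∈ T
      · exact Finset.mem_union_left _ (Finset.mem_union_left _ h1)
      by_cases h2 : s ∈ A \ Y
      · exact Finset.mem_union_left _ (Finset.mem_union_right _ h2)
      exact Finset.mem_union_right _ (Finset.mem_filter.2 ⟨hs, h1, h2⟩)
    have h1 := (Finset.card_le_card hcov).trans (Finset.card_union_le _ _)
    have h2 := Finset.card_union_le T (A \ Y)
    have h3 := Finset.card_sdiff_add_card_eq_card hYA
    omega
  -- there is some vertex
  have hAne : A.Nonempty := by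
    rw [← Finset.card_pos]; omega
  obtain ⟨v0, hv0⟩ := hAne
  have hg0B := (hT v0 hv0).2
  have hdBc := Finset.card_sdiff_add_card_eq_card hBBs
  have hdAc := Finset.card_sdiff_add_card_eq_card hAAs
  have hsum : (A.sigma (fun v => (As \ A).filter (fun s => G.Adj v s ∧
      c s(v, s) ∈ Bs \ B))).card ≤ ((As \ A) ×ˢ (Bs \ B)).card := by
    apply Finset.card_le_card_of_injOn (fun z : (_ : V) × V => (z.2, c s(z.1, z.2)))
    · rintro ⟨v, s⟩ hz
      have hz := Finset.mem_sigma.1 hz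
      have hz2 := Finset.mem_filter.1 hz.2
      exact Finset.mem_coe.2 (Finset.mem_product.2 ⟨hz2.1, hz2.2.2⟩)
    · rintro ⟨v, s⟩ hz ⟨v', s'⟩ hz' he
      have hz2 := Finset.mem_filter.1 (Finset.mem_sigma.1 hz).2
      have hz2' := Finset.mem_filter.1 (Finset.mem_sigma.1 hz').2
      simp only [Prod.mk.injEq] at he
      obtain ⟨rfl, he⟩ := he
      have : v = v' := by
        apply proper_inj hc hz2.2.1.symm hz2'.2.1.symm
        rw [Sym2.eq_swap, he, Sym2.eq_swap]
      subst this
      rfl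
  rw [Finset.card_sigma, Finset.card_product] at hsum
  have hlow : (A.card : ℤ) * (g1 + g0 - 2 * A.card) ≤
      ((∑ v ∈ A, ((As \ A).filter (fun s => G.Adj v s ∧ c s(v, s) ∈ Bs \ B)).card : ℕ) : ℤ) := by
    push_cast
    rw [← nsmul_eq_mul]
    exact Finset.card_nsmul_le_sum _ _ _ (fun v hv => (hT v hv).1)
  have hsum' : ((∑ v ∈ A, ((As \ A).filter (fun s => G.Adj v s ∧ c s(v, s) ∈ Bs \ B)).card : ℕ) : ℤ)
      ≤ ((As \ A).card : ℤ) * (Bs \ B).card := by exact_mod_cast hsum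
  refine hlow.trans (hsum'.trans ?_)
  have e1 : ((As \ A).card : ℤ) = As.card - A.card := by omega
  have e2 : ((Bs \ B).card : ℤ) ≤ As.card - g0 := by omega
  rw [e1]
  apply mul_le_mul_of_nonneg_left e2
  omega

/-- minimal reach among sub-pairs of given size -/
noncomputable def gm (G : SimpleGraph V) (c : Sym2 V → ℕ) (P : Fin k → List V)
    (Js : Finset (Fin k)) (m : ℕ) : ℕ :=
  sInf {x | ∃ P', Steps G c Js P P' ∧ ∃ J' ⊆ Js, J'.card = m ∧ (Reach G c P' J').card = x}

lemma gm_le {Js : Finset (Fin k)} (h : Steps G c Js P P') (hJ : J' ⊆ Js) :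
    gm G c P Js J'.card ≤ (Reach G c P' J').card :=
  Nat.sInf_le ⟨P', h, J', hJ, rfl, rfl⟩

lemma gm_spec {Js : Finset (Fin k)} {m : ℕ} (hm : m ≤ Js.card) :
    ∃ P', Steps G c Js P P' ∧ ∃ J' ⊆ Js, J'.card = m ∧
      (Reach G c P' J').card = gm G c P Js m := by
  obtain ⟨J0, h0, hc0⟩ := Finset.exists_subset_card_eq hm
  exact Nat.sInf_mem (s := {x | ∃ P', Steps G c Js P P' ∧ ∃ J' ⊆ Js, J'.card = m ∧
    (Reach G c P' J').card = x}) ⟨_, P, Relation.ReflTransGen.refl, J0, h0, hc0, rfl⟩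

lemma arith_step {N g g' g1 R : ℤ} (h1 : 10 * N ≤ 11 * R) (hR : R ≤ g) (hR0 : 0 < R)
    (h2 : g * (g1 + g' - 2 * g) ≤ (N - g) * (N - g')) (hg' : g' ≤ N)
    (h3 : 3 * (N - g1) ≤ 2 * (N - g)) : 6 * (N - g) ≤ 5 * (N - g') := by
  -- `10 (N - g) ≤ g`
  have h4 : 10 * (N - g) ≤ g := by linarith
  have hg : 0 < g := by linarith
  have h5 : 10 * (g * (g1 + g' - 2 * g)) ≤ g * (N - g') := by nlinarith
  have h6 : 10 * (g1 + g' - 2 * g) ≤ N - g' := by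
    by_contra hcon
    push Not at hcon
    nlinarith
  linarith

lemma descent (hmin : Minimal G c k) (hc : IsProperEdgeColoring G c) {D : ℕ} (hD : Dense G D)
    {M ℓ R : ℕ} (hM : (Fintype.card V : ℝ) < (6 / 5 : ℝ) ^ M) (hℓ : D + 1 ≤ ℓ) (hR0 : 0 < R)
    (hR : ∀ (P : Fin k → List V) (J : Finset (Fin k)), Valid G c P → ℓ ≤ J.card →
      R ≤ (Reach G c P J).card) (r : ℕ) :
    ∀ (P : Fin k → List V) (Js : Finset (Fin k)), Valid G c P →
      (∀ P', Steps G c Js P P' → (Reach G c P Js).card ≤ (Reach G c P' Js).card) →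
      10 * (Reach G c P Js).card ≤ 11 * R → ℓ + r + M + 2 ≤ Js.card →
      (Reach G c P Js).card < gm G c P Js (Js.card - 1) + 2 ^ r → False := by
  induction r with
  | zero =>
    intro P Js hP hst hN ht hlt
    obtain ⟨P1, hs1, J1, hJ1, hc1, he1⟩ := gm_spec (G := G) (c := c) (P := P) (Js := Js)
      (m := Js.card - 1) (by omega)
    obtain ⟨a, ha, haJ⟩ : ∃ a ∈ Js, a ∉ J1 := by
      apply Finset.exists_mem_notMem_of_card_lt_card; omega
    have hins : insert a J1 ⊆ Js := Finset.insert_subset ha hJ1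
    have h1 := linear_gain hmin hc hD (hs1.valid hP) haJ (by omega)
    have h2 := Finset.card_le_card (Reach_mono (G := G) (c := c) (P := P1) hins)
    have h3 := Finset.card_le_card (Reach_steps hs1)
    simp at hlt
    omega
  | succ r ih =>
    intro P Js hP hst hN ht hlt
    set N := (Reach G c P Js).card with hNdef
    set t := Js.card with htdef
    obtain ⟨P1, hs1, J1, hJ1, hc1, he1⟩ := gm_spec (G := G) (c := c) (P := P) (Js := Js)
      (m := t - 1) (by omega)
    have hNle : ∀ P', Steps G c Js P P' → (Reach G c P' Js).card = N := by
      intro P' h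
      exact le_antisymm (Finset.card_le_card (Reach_steps h)) (hst P' h)
    have hgN : ∀ m ≤ t, gm G c P Js m ≤ N := by
      intro m hm
      obtain ⟨P', hs', J', hJ', hc', he'⟩ := gm_spec (G := G) (c := c) (P := P) (Js := Js) hm
      rw [← he', ← hNle P' hs']
      exact Finset.card_le_card (Reach_mono hJ')
    by_cases hcase : 2 * (N - gm G c P Js (t - 2)) < 3 * (N - gm G c P Js (t - 1))
    · -- descend
      have hsub : ∀ P', Steps G c J1 P1 P' → Steps G c Js P P' := fun P' h =>
        hs1.trans (Steps.mono hJ1 h)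
      refine ih P1 J1 (hs1.valid hP) ?_ ?_ ?_ ?_
      · intro P' h
        rw [he1, ← hc1]
        exact gm_le (hsub P' h) hJ1
      · have := hgN (t - 1) (by omega)
        omega
      · omega
      · obtain ⟨P2, hs2, J2, hJ2, hc2, he2⟩ := gm_spec (G := G) (c := c) (P := P1) (Js := J1)
          (m := J1.card - 1) (by omega)
        have h2 := gm_le (G := G) (c := c) (hsub P2 hs2) (hJ2.trans hJ1)
        rw [hc2, he2, hc1, show t - 1 - 1 = t - 2 by omega] at h2
        rw [he1, hc1, show t - 1 - 1 = t - 2 by omega]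
        have h3 := hgN (t - 1) (by omega)
        have h4 := hgN (t - 2) (by omega)
        rw [pow_succ] at hlt
        omega
    · -- exponential growth of the gaps
      have hG1 : gm G c P Js (t - 1) + 1 ≤ N := by
        obtain ⟨a, ha, haJ⟩ : ∃ a ∈ Js, a ∉ J1 := by
          apply Finset.exists_mem_notMem_of_card_lt_card; omega
        have hins : insert a J1 ⊆ Js := Finset.insert_subset ha hJ1
        have h1 := linear_gain hmin hc hD (hs1.valid hP) haJ (by omega)
        have h2 := Finset.card_le_card (Reach_mono (G := G) (c := c) (P := P1) hins)
        have h3 := hNle P1 hs1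
        omega
      have key : ∀ s, s ≤ M → 3 * ((N : ℤ) - gm G c P Js (t - 1)) ≤
          2 * ((N : ℤ) - gm G c P Js (t - 2 - s)) ∧
          (6 / 5 : ℝ) ^ s ≤ (((N : ℤ) - gm G c P Js (t - 2 - s) : ℤ) : ℝ) := by
        intro s
        induction s with
        | zero =>
          intro _
          have h3 := hgN (t - 1) (by omega)
          have h4 := hgN (t - 2) (by omega)
          constructor
          · simp only [Nat.sub_zero]; omega
          · simp only [Nat.sub_zero, pow_zero]
            have : (1 : ℤ) ≤ (N : ℤ) - gm G c P Js (t - 2) := by omega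
            exact_mod_cast this
        | succ s ihs =>
          intro hs
          obtain ⟨hi1, hi2⟩ := ihs (by omega)
          obtain ⟨Q, hsQ, K, hK, hcK, heK⟩ := gm_spec (G := G) (c := c) (P := P) (Js := Js)
            (m := t - 2 - s) (by omega)
          have hQ := hsQ.valid hP
          have hcount := count hmin hc hD hQ hK (by omega) (by omega) (gm G c P Js (t - 2 - (s + 1)))
            (gm G c P Js (t - 1)) (by
              intro P' h J' hJ' hcJ'
              rw [show t - 1 = J'.card by omega]
              exact gm_le (hsQ.trans h) hJ') (by
              intro P' h J' hJ' hcJ'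
              rw [show t - 2 - (s + 1) = J'.card by omega]
              exact gm_le (hsQ.trans h) hJ')
          rw [hNle Q hsQ, heK] at hcount
          have hRg : R ≤ gm G c P Js (t - 2 - s) := by
            rw [← heK]; exact hR Q K hQ (by omega)
          have h3 := hgN (t - 2 - (s + 1)) (by omega)
          have hst := arith_step (R := R) (by exact_mod_cast hN) (by exact_mod_cast hRg)
            (by exact_mod_cast hR0) hcount (by exact_mod_cast h3) hi1
          constructor
          · have h4 := hgN (t - 2 - s) (by omega)
            omega
          · have h5 : (6 : ℝ) * (((N : ℤ) - gm G c P Js (t - 2 - s) : ℤ) : ℝ) ≤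
                5 * (((N : ℤ) - gm G c P Js (t - 2 - (s + 1)) : ℤ) : ℝ) := by exact_mod_cast hst
            rw [pow_succ]
            linarith
      have h1 := (key M le_rfl).2
      have h2 : N ≤ Fintype.card V := Finset.card_le_univ _
      have h3 : (((N : ℤ) - gm G c P Js (t - 2 - M) : ℤ) : ℝ) ≤ (Fintype.card V : ℝ) := by
        have : (N : ℤ) - gm G c P Js (t - 2 - M) ≤ (Fintype.card V : ℤ) := by omega
        exact_mod_cast this
      linarith

lemma growth (hmin : Minimal G c k) (hc : IsProperEdgeColoring G c) {D : ℕ} (hD : Dense G D)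
    {M r : ℕ} (hM : (Fintype.card V : ℝ) < (6 / 5 : ℝ) ^ M) (hr : Fintype.card V < 2 ^ r) (i : ℕ) :
    ∀ (P : Fin k → List V) (J : Finset (Fin k)), Valid G c P →
      D + 1 + i * (r + M + 2) ≤ J.card → (11 / 10 : ℝ) ^ i ≤ (Reach G c P J).card := by
  induction i with
  | zero =>
    intro P J hP hJ
    have := card_BC hmin hP J
    rw [pow_zero]
    have h1 : 1 ≤ (Reach G c P J).card := by omega
    exact_mod_cast h1
  | succ i ih =>
    intro P J hP hJ
    by_contra hcon
    push Not at hcon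
    set t := D + 1 + (i + 1) * (r + M + 2) with ht
    obtain ⟨J0, hJ0, hcJ0⟩ := Finset.exists_subset_card_eq hJ
    set S : Set ℕ := {x | ∃ (P : Fin k → List V) (J : Finset (Fin k)), Valid G c P ∧ J.card = t ∧
      (Reach G c P J).card = x} with hS
    have hSne : S.Nonempty := ⟨_, P, J0, hP, hcJ0, rfl⟩
    obtain ⟨Ps, Js, hPs, hcJs, hes⟩ := Nat.sInf_mem hSne
    have hNs : ((Reach G c Ps Js).card : ℝ) < (11 / 10 : ℝ) ^ (i + 1) := by
      refine lt_of_le_of_lt ?_ hcon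
      have h1 : sInf S ≤ (Reach G c P J0).card := Nat.sInf_le ⟨P, J0, hP, hcJ0, rfl⟩
      have h2 := Finset.card_le_card (Reach_mono (G := G) (c := c) (P := P) hJ0)
      rw [hes]
      exact_mod_cast h1.trans h2
    have hRpos : 0 < ⌈(11 / 10 : ℝ) ^ i⌉₊ := Nat.ceil_pos.2 (by positivity)
    have htt : t = D + 1 + i * (r + M + 2) + (r + M + 2) := by rw [ht]; ring
    refine descent hmin hc hD hM (ℓ := D + 1 + i * (r + M + 2)) (by omega) hRpos
      (fun P J hP hJ => Nat.ceil_le.2 (ih P J hP hJ)) r Ps Js hPs ?_ ?_ (by omega) ?_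
    · intro P' h
      rw [hes]
      exact Nat.sInf_le ⟨P', Js, h.valid hPs, hcJs, rfl⟩
    · have h1 := Nat.le_ceil ((11 / 10 : ℝ) ^ i)
      rw [pow_succ] at hNs
      have : (10 : ℝ) * (Reach G c Ps Js).card ≤ 11 * (⌈(11 / 10 : ℝ) ^ i⌉₊ : ℝ) := by linarith
      exact_mod_cast this
    · have := Finset.card_le_univ (Reach G c Ps Js)
      omega

lemma bound (hmin : Minimal G c k) (hc : IsProperEdgeColoring G c) {D : ℕ} (hD : Dense G D)
    (hP : Valid G c P) {M r i : ℕ} (hM : (Fintype.card V : ℝ) < (6 / 5 : ℝ) ^ M)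
    (hr : Fintype.card V < 2 ^ r) (hi : (Fintype.card V : ℝ) < (11 / 10 : ℝ) ^ i) :
    k ≤ D + i * (r + M + 2) := by
  by_contra hcon
  push Not at hcon
  have h1 := growth hmin hc hD hM hr i P Finset.univ hP (by
    rw [Finset.card_univ, Fintype.card_fin]; omega)
  have h2 : ((Reach G c P Finset.univ).card : ℝ) ≤ Fintype.card V := by
    exact_mod_cast Finset.card_le_univ _
  linarith

end Count
end RPF

namespace RPF

lemma valid_singletons {n : ℕ} (G : SimpleGraph (Fin n)) (c : Sym2 (Fin n) → ℕ) :
    Valid G c (fun i : Fin n => [i]) := by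
  refine ⟨by simp, by simp, ?_, by simp [colM_single]⟩
  have : ∀ i : Fin n, verM [i] = {i} := fun i => rfl
  simp only [this]
  exact Finset.sum_multiset_singleton _

lemma coe_flatMap_ofFn {α β : Type} {k : ℕ} (P : Fin k → List α) (f : List α → List β) :
    (((List.ofFn P).flatMap f : List β) : Multiset β) = ∑ i, ((f (P i) : List β) : Multiset β) := by
  induction k with
  | zero => simp
  | succ k ih =>
    rw [List.ofFn_succ, List.flatMap_cons, Fin.sum_univ_succ, ← ih, Multiset.coe_add]

lemma pow_bounds (n : ℕ) :
    n < 2 ^ (Nat.log 2 n + 1) ∧ (n : ℝ) < (6 / 5 : ℝ) ^ (4 * (Nat.log 2 n + 1)) ∧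
      (n : ℝ) < (11 / 10 : ℝ) ^ (8 * (Nat.log 2 n + 1)) := by
  have h := Nat.lt_pow_succ_log_self (b := 2) (by norm_num) n
  have h' : (n : ℝ) < 2 ^ (Nat.log 2 n + 1) := by exact_mod_cast h
  refine ⟨h, ?_, ?_⟩
  · rw [pow_mul]
    exact h'.trans_le (pow_le_pow_left₀ (by norm_num) (by norm_num) _)
  · rw [pow_mul]
    exact h'.trans_le (pow_le_pow_left₀ (by norm_num) (by norm_num) _)

lemma dense_of_degree {n : ℕ} {δ : ℝ} (hδ : 0 < δ) (G : SimpleGraph (Fin n))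
    (h : ∀ v, (1 - δ) * n ≤ ((G.neighborSet v).ncard : ℝ)) : Dense G ⌊δ * n⌋₊ := by
  intro v
  apply Nat.le_floor
  have h1 := h v
  have h2 : (G.neighborSet v).ncard = (Finset.univ.filter (fun s => G.Adj v s)).card := by
    rw [← Set.ncard_coe_finset]
    congr 1
    ext s
    simp
  have h3 := Finset.card_filter_add_card_filter_not (s := (Finset.univ : Finset (Fin n)))
    (fun s => G.Adj v s)
  rw [Finset.card_univ, Fintype.card_fin] at h3
  rw [h2] at h1
  have h4 : ((Finset.univ.filter (fun s => G.Adj v s)).card : ℝ)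
    + ((Finset.univ.filter (fun s => ¬ G.Adj v s)).card : ℝ) = n := by exact_mod_cast h3
  linarith

end RPF

/-- There exists a constant `C` such that for every `n` and every `δ = δ(n) > 0`, if `G` is
a properly edge-colored graph on `n` vertices with minimum degree at least `(1 - δ)n`, then
`G` contains a spanning rainbow path forest with at most `C (log₂ n)² + 3 δ n` paths
(single vertices count as paths). -/
theorem spanning_rainbow_path_forest :
    ∃ C : ℝ, ∀ n : ℕ, ∀ δ : ℝ, 0 < δ →
      ∀ (G : SimpleGraph (Fin n)) (c : Sym2 (Fin n) → ℕ),
        IsProperEdgeColoring G c →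
        (∀ v, (1 - δ) * n ≤ ((G.neighborSet v).ncard : ℝ)) →
        ∃ (k : ℕ) (P : Fin k → List (Fin n)),
          (∀ i, P i ≠ [] ∧ IsPathIn G (P i)) ∧
          (∀ i j, i ≠ j → ∀ v, v ∈ P i → v ∉ P j) ∧
          (((List.ofFn P).flatMap listEdges).map c).Nodup ∧
          (∀ v, ∃ i, v ∈ P i) ∧
          (k : ℝ) ≤ C * (Real.logb 2 n) ^ 2 + 3 * δ * n := by
  refine ⟨224, ?_⟩
  intro n δ hδ G c hc hdeg
  have hex : ∃ k, ∃ P : Fin k → List (Fin n), RPF.Valid G c P :=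
    ⟨n, _, RPF.valid_singletons G c⟩
  obtain ⟨P, hP⟩ := Nat.find_spec hex
  have hmin : RPF.Minimal G c (Nat.find hex) := fun k' hk' P' hP' =>
    Nat.find_min hex hk' ⟨P', hP'⟩
  have hkn : Nat.find hex ≤ n := Nat.find_min' hex ⟨_, RPF.valid_singletons G c⟩
  refine ⟨Nat.find hex, P, ?_, ?_, ?_, ?_, ?_⟩
  · exact fun i => ⟨hP.ne i, hP.chain i, hP.nodup i⟩
  · exact fun i j hij v hi hj => hij (hP.disj hi hj)
  · have h := hP.col
    have e : ((((List.ofFn P).flatMap listEdges).map c : List ℕ) : Multiset ℕ)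
        = ∑ i, RPF.colM c (P i) := by
      rw [List.map_flatMap, RPF.coe_flatMap_ofFn]
      rfl
    rw [← e] at h
    exact h
  · intro v
    have h : v ∈ ∑ i, RPF.verM (P i) := by rw [hP.ver]; simp
    rw [Multiset.mem_sum] at h
    obtain ⟨i, _, hi⟩ := h
    exact ⟨i, hi⟩
  · have hkn' : ((Nat.find hex : ℕ) : ℝ) ≤ n := by exact_mod_cast hkn
    rcases Nat.lt_or_ge n 2 with hn | hn
    · have hsq : 0 ≤ (224 : ℝ) * Real.logb 2 n ^ 2 := by positivity
      interval_cases n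
      · have : (0 : ℝ) ≤ 3 * δ * ((0 : ℕ) : ℝ) := by simp
        push_cast at *
        linarith
      · have h0 := hdeg 0
        have h1 : G.neighborSet 0 = ∅ := by
          ext s
          have : s = 0 := Subsingleton.elim _ _
          subst this
          simp
        rw [h1] at h0
        simp at h0
        push_cast at *
        linarith
    · obtain ⟨h1, h2, h3⟩ := RPF.pow_bounds n
      have hb := RPF.bound hmin hc (RPF.dense_of_degree hδ G hdeg) hP
        (by rw [Fintype.card_fin]; exact h2) (by rw [Fintype.card_fin]; exact h1)
        (by rw [Fintype.card_fin]; exact h3)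
      set l := Nat.log 2 n with hl
      have hb' : ((Nat.find hex : ℕ) : ℝ) ≤ (⌊δ * n⌋₊ : ℝ) +
          8 * ((l : ℝ) + 1) * (((l : ℝ) + 1) + 4 * ((l : ℝ) + 1) + 2) := by exact_mod_cast hb
      have hfl : (⌊δ * n⌋₊ : ℝ) ≤ δ * n := Nat.floor_le (by positivity)
      have hn0 : (0 : ℝ) < n := by positivity
      have hlL : (l : ℝ) ≤ Real.logb 2 n := by
        rw [Real.le_logb_iff_rpow_le (by norm_num) hn0, Real.rpow_natCast]
        exact_mod_cast Nat.pow_log_le_self 2 (by omega)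
      have h1L : (1 : ℝ) ≤ Real.logb 2 n := by
        rw [Real.le_logb_iff_rpow_le (by norm_num) hn0, Real.rpow_one]
        exact_mod_cast hn
      have hl0 : (0 : ℝ) ≤ l := Nat.cast_nonneg _
      have hδn : 0 ≤ δ * n := by positivity
      generalize Real.logb 2 (n : ℝ) = L at *
      have hsq : ((l : ℝ) + 1) ^ 2 ≤ (2 * L) ^ 2 := pow_le_pow_left₀ (by linarith) (by linarith) 2
      nlinarith
end

section
/- Suppose 0 < c ≤ 1 and n_1, ..., n_k is a strictly increasing sequence of positive integers such that for all m ≤ j < ℓ ≤ k one has n_j - n_{j-1} ≥ ((n_ℓ - n_j)/n_j) · ((1 + c) n_j - (2 n_ℓ - n_{ℓ-1})). Then k ≤ (log_r n_k)^2 + 2 log_r n_k + m + 1, where r = 1 + c/3. -/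
/-- Suppose `0 < c ≤ 1` and `n_1, …, n_k` is a strictly increasing sequence of positive
integers such that for all `m ≤ j < ℓ ≤ k` one has
`n_j - n_{j-1} ≥ ((n_ℓ - n_j)/n_j) ((1+c) n_j - (2 n_ℓ - n_{ℓ-1}))`.
Then `k ≤ (log_r n_k)² + 2 log_r n_k + m + 1`, where `r = 1 + c/3`. -/
theorem sequence_length_bound (c : ℝ) (hc0 : 0 < c) (hc1 : c ≤ 1)
    (k m : ℕ) (hm1 : 1 ≤ m) (hmk : m ≤ k) (n : ℕ → ℕ)
    (hpos : ∀ i, 1 ≤ i → i ≤ k → 0 < n i)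
    (hmono : ∀ i j, 1 ≤ i → i < j → j ≤ k → n i < n j)
    (hineq : ∀ j ℓ, m ≤ j → j < ℓ → ℓ ≤ k →
      ((n ℓ : ℝ) - (n j : ℝ)) / (n j : ℝ) *
          ((1 + c) * (n j : ℝ) - (2 * (n ℓ : ℝ) - (n (ℓ - 1) : ℝ))) ≤
        (n j : ℝ) - (n (j - 1) : ℝ)) :
    (k : ℝ) ≤ (Real.logb (1 + c / 3) (n k)) ^ 2 + 2 * Real.logb (1 + c / 3) (n k)
        + (m : ℝ) + 1 := by
  set r : ℝ := 1 + c / 3 with hr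
  have hr1 : 1 < r := by rw [hr]; linarith
  have hr0 : 0 < r := by linarith
  have hle : ∀ i j, 1 ≤ i → i ≤ j → j ≤ k → (n i : ℝ) ≤ n j := by
    intro i j hi hij hj
    rcases hij.eq_or_lt with h | h
    · rw [h]
    · exact_mod_cast (hmono i j hi h hj).le
  have A : ∀ j l, m ≤ j → j < l → l ≤ k → (n l : ℝ) ≤ r * n j →
      r * ((n l : ℝ) - n j) ≤ (n l : ℝ) - (n (j - 1) : ℝ) := by
    intro j l hj hjl hl h
    have h1 := hineq j l hj hjl hl
    have h2 := hle j (l - 1) (by omega) (by omega) (by omega)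
    have h3 := hle j l (by omega) hjl.le hl
    have hp : (0 : ℝ) < n j := by exact_mod_cast hpos j (by omega) (by omega)
    have h4 : c / 3 * n j ≤ (1 + c) * (n j : ℝ) - (2 * (n l : ℝ) - (n (l - 1) : ℝ)) := by
      rw [hr] at h
      linarith
    have h5 : 0 ≤ ((n l : ℝ) - n j) / n j := div_nonneg (by linarith) hp.le
    have h6 := mul_le_mul_of_nonneg_left h4 h5
    have h7 : ((n l : ℝ) - n j) / n j * (c / 3 * n j) = c / 3 * ((n l : ℝ) - n j) := by
      field_simp
    rw [hr]
    linarith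
  have B : ∀ l, l ≤ k → ∀ t j, m ≤ j → j + 1 + t = l → (n l : ℝ) ≤ r * n j →
      r ^ (t + 1) ≤ (n l : ℝ) - (n (j - 1) : ℝ) := by
    intro l hl t
    induction t with
    | zero =>
      intro j hj hjl h
      have h1 := A j l hj (by omega) hl h
      have h2 : (n j : ℝ) + 1 ≤ n l := by
        exact_mod_cast hmono j l (by omega) (by omega) hl
      have h3 : r * 1 ≤ r * ((n l : ℝ) - n j) :=
        mul_le_mul_of_nonneg_left (by linarith) hr0.le
      simp only [zero_add, pow_one]
      linarith
    | succ t ih =>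
      intro j hj hjl h
      have h1 := A j l hj (by omega) hl h
      have h0 := hle j (j + 1) (by omega) (by omega) (by omega)
      have h2 := ih (j + 1) (by omega) (by omega)
        (h.trans (mul_le_mul_of_nonneg_left h0 hr0.le))
      rw [Nat.add_sub_cancel] at h2
      have h3 := mul_le_mul_of_nonneg_left h2 hr0.le
      rw [pow_succ' r (t + 1)]
      linarith
  have L0 : ∀ l, 1 ≤ l → l ≤ k → 0 ≤ Real.logb r (n l) := by
    intro l h1 h2
    exact Real.logb_nonneg hr1 (by exact_mod_cast hpos l h1 h2)
  have C : ∀ l, l ≤ k → ∀ j, m ≤ j → j ≤ l → (n l : ℝ) ≤ r * n j →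
      (l : ℝ) - j ≤ Real.logb r (n l) := by
    intro l hl j hj hjl h
    rcases hjl.eq_or_lt with e | e
    · rw [e, sub_self]
      exact L0 l (by omega) hl
    · obtain ⟨t, rfl⟩ := Nat.exists_eq_add_of_le (Nat.succ_le_of_lt e)
      have h1 := B _ hl t j hj rfl h
      have hp : (0 : ℝ) < n (j.succ + t) := by
        exact_mod_cast hpos _ (by omega) hl
      rw [Real.le_logb_iff_rpow_le hr1 hp]
      have h2 : (((j.succ + t : ℕ) : ℝ) - j) = ((t + 1 : ℕ) : ℝ) := by
        push_cast
        ring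
      rw [h2, Real.rpow_natCast]
      have h3 : (0 : ℝ) ≤ n (j - 1) := Nat.cast_nonneg _
      have h4 : r ^ (t + 1) ≤ (n (j.succ + t) : ℝ) - (n (j - 1) : ℝ) := h1
      linarith
  have D : ∀ l, m ≤ l → l ≤ k → (l : ℝ) - m ≤ (Real.logb r (n l) + 1) ^ 2 := by
    intro l
    induction l using Nat.strong_induction_on with
    | _ l ih =>
      intro hml hl
      have hL := L0 l (by omega) hl
      have hpl : (0 : ℝ) < n l := by exact_mod_cast hpos l (by omega) hl
      classical
      have hex : ∃ j, m ≤ j ∧ (n l : ℝ) ≤ r * n j := ⟨l, hml, by nlinarith⟩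
      obtain ⟨j, hj1, hj2, hjl, hmin⟩ : ∃ j, m ≤ j ∧ (n l : ℝ) ≤ r * n j ∧ j ≤ l ∧
          ∀ i, i < j → ¬ (m ≤ i ∧ (n l : ℝ) ≤ r * n i) :=
        ⟨Nat.find hex, (Nat.find_spec hex).1, (Nat.find_spec hex).2,
          Nat.find_min' hex ⟨hml, by nlinarith⟩, fun i hi => Nat.find_min hex hi⟩
      have h1 := C l hl j hj1 hjl hj2
      rcases hj1.eq_or_lt with e | e
      · rw [← e] at h1
        nlinarith
      · obtain ⟨i, rfl⟩ : ∃ i, j = i + 1 := ⟨j - 1, by omega⟩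
        have h2 := ih i (by omega) (by omega) (by omega)
        have h3 : r * n i < (n l : ℝ) := by
          by_contra h
          exact hmin i (by omega) ⟨by omega, not_lt.mp h⟩
        have hpi : (0 : ℝ) < n i := by exact_mod_cast hpos i (by omega) (by omega)
        have h4 : Real.logb r (n i) + 1 ≤ Real.logb r (n l) := by
          have h5 := Real.logb_le_logb_of_le hr1 (by positivity) h3.le
          rw [Real.logb_mul hr0.ne' hpi.ne', Real.logb_self_eq_one hr1] at h5
          linarith
        have h6 := L0 i (by omega) (by omega)
        have h7 : (Real.logb r (n i) + 1) ^ 2 ≤ Real.logb r (n l) ^ 2 :=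
          pow_le_pow_left₀ (by linarith) h4 2
        push_cast at h1
        nlinarith
  have h := D k hmk le_rfl
  nlinarith
end

section
/- Suppose 0 < c ≤ 1, r = 1 + c/3, and n_1, ..., n_k is a strictly increasing sequence of positive integers such that for all m ≤ j < ℓ ≤ k one has n_j - n_{j-1} ≥ ((n_ℓ - n_j)/n_j) · ((1 + c) n_j - (2 n_ℓ - n_{ℓ-1})). Then for all m ≤ j < ℓ ≤ k, if n_ℓ ≤ r n_j, then n_ℓ - n_j ≤ r^{-1} (n_ℓ - n_{j-1}). -/
/-- Suppose `0 < c ≤ 1`, `r = 1 + c/3`, and `n_1, …, n_k` is a strictly increasing sequence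
of positive integers such that for all `m ≤ j < ℓ ≤ k` one has
`n_j - n_{j-1} ≥ ((n_ℓ - n_j)/n_j) ((1+c) n_j - (2 n_ℓ - n_{ℓ-1}))`.
Then for all `m ≤ j < ℓ ≤ k`, if `n_ℓ ≤ r n_j` then `n_ℓ - n_j ≤ r⁻¹ (n_ℓ - n_{j-1})`. -/
theorem sequence_gap_contraction (c r : ℝ) (hc0 : 0 < c) (hc1 : c ≤ 1)
    (hr : r = 1 + c / 3)
    (k m : ℕ) (hm1 : 1 ≤ m) (hmk : m ≤ k) (n : ℕ → ℕ)
    (hpos : ∀ i, 1 ≤ i → i ≤ k → 0 < n i)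
    (hmono : ∀ i j, 1 ≤ i → i < j → j ≤ k → n i < n j)
    (hineq : ∀ j ℓ, m ≤ j → j < ℓ → ℓ ≤ k →
      ((n ℓ : ℝ) - (n j : ℝ)) / (n j : ℝ) *
          ((1 + c) * (n j : ℝ) - (2 * (n ℓ : ℝ) - (n (ℓ - 1) : ℝ))) ≤
        (n j : ℝ) - (n (j - 1) : ℝ)) :
    ∀ j ℓ, m ≤ j → j < ℓ → ℓ ≤ k → (n ℓ : ℝ) ≤ r * (n j : ℝ) →
      (n ℓ : ℝ) - (n j : ℝ) ≤ r⁻¹ * ((n ℓ : ℝ) - (n (j - 1) : ℝ)) := by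
  intro j l hj hjl hlk hle
  have h := hineq j l hj hjl hlk
  have hnj : (0 : ℝ) < n j := by
    exact_mod_cast hpos j (by omega) (by omega)
  have hlt : (n j : ℝ) < n l := by
    exact_mod_cast hmono j l (by omega) hjl hlk
  have hpred : (n j : ℝ) ≤ n (l - 1) := by
    rcases Nat.lt_or_ge j (l - 1) with h1 | h1
    · exact_mod_cast (hmono j (l - 1) (by omega) h1 (by omega)).le
    · have : l - 1 = j := by omega
      rw [this]
  have hr0 : 0 < r := by rw [hr]; positivity
  have hfac : c / 3 * (n j : ℝ) ≤
      (1 + c) * (n j : ℝ) - (2 * (n l : ℝ) - (n (l - 1) : ℝ)) := by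
    rw [hr] at hle
    linarith
  have hq : 0 ≤ ((n l : ℝ) - n j) / n j := div_nonneg (by linarith) hnj.le
  have h2 := mul_le_mul_of_nonneg_left hfac hq
  have h3 : ((n l : ℝ) - n j) / n j * (c / 3 * (n j : ℝ)) = c / 3 * ((n l : ℝ) - n j) := by
    field_simp
  rw [inv_mul_eq_div, le_div_iff₀ hr0, hr]
  linarith
end

section
/- Suppose 0 < c ≤ 1, r = 1 + c/3, and n_1, ..., n_k is a strictly increasing sequence of positive integers such that for all m ≤ j < ℓ ≤ k one has n_j - n_{j-1} ≥ ((n_ℓ - n_j)/n_j) · ((1 + c) n_j - (2 n_ℓ - n_{ℓ-1})). Then for all m ≤ j < ℓ ≤ k, if n_ℓ ≤ r n_j, then ℓ - j < log_r n_j. -/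
/-- Suppose `0 < c ≤ 1`, `r = 1 + c/3`, and `n_1, …, n_k` is a strictly increasing sequence
of positive integers such that for all `m ≤ j < ℓ ≤ k` one has
`n_j - n_{j-1} ≥ ((n_ℓ - n_j)/n_j) ((1+c) n_j - (2 n_ℓ - n_{ℓ-1}))`.
Then for all `m ≤ j < ℓ ≤ k`, if `n_ℓ ≤ r n_j` then `ℓ - j < log_r n_j`. -/
theorem sequence_index_gap_bound (c r : ℝ) (hc0 : 0 < c) (hc1 : c ≤ 1)
    (hr : r = 1 + c / 3)
    (k m : ℕ) (hm1 : 1 ≤ m) (hmk : m ≤ k) (n : ℕ → ℕ)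
    (hpos : ∀ i, 1 ≤ i → i ≤ k → 0 < n i)
    (hmono : ∀ i j, 1 ≤ i → i < j → j ≤ k → n i < n j)
    (hineq : ∀ j ℓ, m ≤ j → j < ℓ → ℓ ≤ k →
      ((n ℓ : ℝ) - (n j : ℝ)) / (n j : ℝ) *
          ((1 + c) * (n j : ℝ) - (2 * (n ℓ : ℝ) - (n (ℓ - 1) : ℝ))) ≤
        (n j : ℝ) - (n (j - 1) : ℝ)) :
    ∀ j ℓ, m ≤ j → j < ℓ → ℓ ≤ k → (n ℓ : ℝ) ≤ r * (n j : ℝ) →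
      (ℓ : ℝ) - (j : ℝ) < Real.logb r (n j) := by
  intro j l hmj hjl hlk hle
  have hr1 : 1 < r := by rw [hr]; linarith
  have hnj : (0 : ℝ) < n j := by exact_mod_cast hpos j (by omega) (by omega)
  have hstep : ∀ i, j ≤ i → i < l →
      c / 3 * ((n l : ℝ) - n i) ≤ (n i : ℝ) - n (i - 1) := by
    intro i hji hil
    have h := hineq i l (by omega) hil hlk
    have hni : (0 : ℝ) < n i := by exact_mod_cast hpos i (by omega) (by omega)
    have hji' : (n j : ℝ) ≤ n i := by
      rcases hji.eq_or_lt with e | e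
      · rw [e]
      · exact_mod_cast (hmono j i (by omega) e (by omega)).le
    have hil' : (n i : ℝ) ≤ n (l - 1) := by
      rcases (show i ≤ l - 1 by omega).eq_or_lt with e | e
      · rw [e]
      · exact_mod_cast (hmono i (l - 1) (by omega) e (by omega)).le
    have hlt : (n i : ℝ) < n l := by exact_mod_cast hmono i l (by omega) hil hlk
    have hl : (n l : ℝ) ≤ r * n i := hle.trans (by gcongr)
    have hb : c / 3 * n i ≤ (1 + c) * (n i : ℝ) - (2 * (n l : ℝ) - (n (l - 1) : ℝ)) := by
      rw [hr] at hl
      linarith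
    have hq : 0 ≤ ((n l : ℝ) - (n i : ℝ)) / (n i : ℝ) :=
      div_nonneg (by linarith) hni.le
    have h2 := mul_le_mul_of_nonneg_left hb hq
    have h3 : ((n l : ℝ) - (n i : ℝ)) / (n i : ℝ) * (c / 3 * n i)
        = c / 3 * ((n l : ℝ) - n i) := by
      field_simp
    linarith
  have hpow : ∀ t : ℕ, j + t + 1 ≤ l → r ^ t ≤ (n l : ℝ) - n (l - 1 - t) := by
    intro t
    induction t with
    | zero =>
      intro h
      have h1 : n (l - 1) + 1 ≤ n l := hmono (l - 1) l (by omega) (by omega) hlk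
      have h2 : (n (l - 1) : ℝ) + 1 ≤ n l := by exact_mod_cast h1
      simp only [pow_zero, Nat.sub_zero]
      linarith
    | succ t ih =>
      intro h
      have h1 := ih (by omega)
      have h2 := hstep (l - 1 - t) (by omega) (by omega)
      have e : l - 1 - (t + 1) = l - 1 - t - 1 := by omega
      rw [e, pow_succ]
      have h3 := mul_le_mul_of_nonneg_right h1 (by linarith : (0 : ℝ) ≤ r)
      rw [hr] at h3 ⊢
      linarith
  have hfin := hpow (l - 1 - j) (by omega)
  rw [show l - 1 - (l - 1 - j) = j by omega] at hfin
  have hlt : r ^ (l - j) < n j := by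
    rw [show l - j = (l - 1 - j) + 1 by omega, pow_succ]
    have h3 := mul_le_mul_of_nonneg_right hfin (by linarith : (0 : ℝ) ≤ r)
    have h4 : (n l : ℝ) - n j ≤ c / 3 * n j := by rw [hr] at hle; linarith
    have h5 := mul_le_mul_of_nonneg_right h4 (by linarith : (0 : ℝ) ≤ r)
    have h6 : c / 3 * r < 1 := by rw [hr]; nlinarith
    have h7 := mul_lt_mul_of_pos_right h6 hnj
    linarith
  rw [Real.lt_logb_iff_rpow_lt hr1 hnj, ← Nat.cast_sub hjl.le, Real.rpow_natCast]
  exact hlt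
end

section
/- Let 0 < a ≤ b, δ > 0, and let V be a vertex set with |V| = n such that n ≥ 2b + 3a + 4δn. Let P_1 be a rainbow path v_1, ..., v_m on m ≥ n - 4δn - a vertices of V, and let H_1 and H_2 be edge-disjoint (a,b)-expanders on vertex set V, such that the sets of colors used on the edges of P_1, of H_1, and of H_2 are pairwise disjoint, and such that H_1 and H_2 are each properly edge-colored. Then there exists a rainbow cycle on at least n - 4δn - 3a vertices in the union of P_1, H_1 and H_2. -/
open scoped Classical

/-- Walk along consecutive values of `f`. -/
lemma exists_range_walk {V : Type*} (G : SimpleGraph V) (f : ℕ → V) (d : ℕ) :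
    ∀ i : ℕ, (∀ k, i ≤ k → k < i + d → G.Adj (f k) (f (k + 1))) →
    ∃ w : G.Walk (f i) (f (i + d)), w.support = (List.range' i (d + 1)).map f ∧
      w.edges = (List.range' i d).map (fun k => s(f k, f (k + 1))) := by
  induction d with
  | zero => intro i _; exact ⟨SimpleGraph.Walk.nil, by simp, by simp⟩
  | succ d ih =>
    intro i h
    obtain ⟨w, hs, he⟩ := ih (i + 1) (fun k h1 h2 => h k (by omega) (by omega))
    have e : i + 1 + d = i + (d + 1) := by omega
    refine ⟨(SimpleGraph.Walk.cons (h i le_rfl (by omega)) w).copy rfl (by rw [e]), ?_, ?_⟩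
    · rw [SimpleGraph.Walk.support_copy, SimpleGraph.Walk.support_cons, hs,
        List.range'_succ (n := d + 1)]
      simp
    · rw [SimpleGraph.Walk.edges_copy, SimpleGraph.Walk.edges_cons, he,
        List.range'_succ (n := d)]
      simp

/-- Few vertices outside a set of `a` vertices are nonadjacent to it (from (E3)). -/
lemma card_nonadj_lt {V : Type*} [Fintype V] {H : SimpleGraph V} {a b : ℕ}
    (hH : IsExpander H a b) (f : ℕ → V) (m : ℕ) (hf : Set.InjOn f {k | k < m})
    (S T : Finset ℕ) (hS : ∀ x ∈ S, x < m) (hT : ∀ x ∈ T, x < m) (hd : Disjoint S T)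
    (hc : S.card = a) (hn : ∀ s ∈ S, ∀ t ∈ T, ¬ H.Adj (f s) (f t)) : T.card < b := by
  by_contra hb
  obtain ⟨T', hT', hcard⟩ := Finset.exists_subset_card_eq (not_lt.mp hb)
  have h1 : (S.image f).card = a := by
    rw [Finset.card_image_of_injOn, hc]
    exact fun x hx y hy h => hf (hS x hx) (hS y hy) h
  have h2 : (T'.image f).card = b := by
    rw [Finset.card_image_of_injOn, hcard]
    exact fun x hx y hy h => hf (hT x (hT' hx)) (hT y (hT' hy)) h
  have h3 : Disjoint (S.image f) (T'.image f) := by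
    rw [Finset.disjoint_left]
    intro v hv hv'
    obtain ⟨x, hx, rfl⟩ := Finset.mem_image.mp hv
    obtain ⟨y, hy, hxy⟩ := Finset.mem_image.mp hv'
    have := hf (hT y (hT' hy)) (hS x hx) hxy
    subst this
    exact Finset.disjoint_left.mp hd hx (hT' hy)
  obtain ⟨u, hu, v, hv, huv⟩ := hH.2.2 _ _ h3 h1 h2
  obtain ⟨x, hx, rfl⟩ := Finset.mem_image.mp hu
  obtain ⟨y, hy, rfl⟩ := Finset.mem_image.mp hv
  exact hn x hx y (hT' hy) huv

/-- Let `0 < a ≤ b`, `δ > 0`, and let the vertex set have `n ≥ 2b + 3a + 4δn` elements.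
Let `P₁` be a rainbow path on `m ≥ n - 4δn - a` vertices and let `H₁`, `H₂` be
edge-disjoint, properly edge-colored `(a,b)`-expanders such that the color sets of `P₁`,
`H₁` and `H₂` are pairwise disjoint.  Then the union of `P₁`, `H₁` and `H₂` contains a
rainbow cycle on at least `n - 4δn - 3a` vertices. -/
theorem rainbow_cycle_from_path_and_expanders (n a b : ℕ) (δ : ℝ)
    (ha : 0 < a) (hab : a ≤ b) (hδ : 0 < δ)
    (hn : 2 * (b : ℝ) + 3 * (a : ℝ) + 4 * δ * (n : ℝ) ≤ (n : ℝ))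
    (P₁ : List (Fin n)) (c : Sym2 (Fin n) → ℕ) (H₁ H₂ : SimpleGraph (Fin n))
    (hP₁nodup : P₁.Nodup)
    (hP₁len : (n : ℝ) - 4 * δ * (n : ℝ) - (a : ℝ) ≤ (P₁.length : ℝ))
    (hP₁rainbow : ((listEdges P₁).map c).Nodup)
    (hedgedisj : Disjoint H₁.edgeSet H₂.edgeSet)
    (hexp₁ : IsExpander H₁ a b) (hexp₂ : IsExpander H₂ a b)
    (hc₁ : Disjoint (c '' {e | e ∈ listEdges P₁}) (c '' H₁.edgeSet))
    (hc₂ : Disjoint (c '' {e | e ∈ listEdges P₁}) (c '' H₂.edgeSet))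
    (hc₃ : Disjoint (c '' H₁.edgeSet) (c '' H₂.edgeSet))
    (hp₁ : IsProperEdgeColoring H₁ c) (hp₂ : IsProperEdgeColoring H₂ c) :
    ∃ (v : Fin n) (w : (SimpleGraph.fromEdgeSet
        ({e | e ∈ listEdges P₁} ∪ H₁.edgeSet ∪ H₂.edgeSet)).Walk v v),
      w.IsCycle ∧ (w.edges.map c).Nodup ∧
      (n : ℝ) - 4 * δ * (n : ℝ) - 3 * (a : ℝ) ≤ (w.length : ℝ) := by
  have hm : 2 * b + 2 * a ≤ P₁.length := by
    have : (2 * b + 2 * a : ℝ) ≤ P₁.length := by linarith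
    exact_mod_cast this
  obtain ⟨m, hmdef⟩ : ∃ m, m = P₁.length := ⟨_, rfl⟩
  have hmpos : 0 < P₁.length := by omega
  let f : ℕ → Fin n := fun k => P₁.getD k (P₁[0])
  have hfk : ∀ k (hk : k < P₁.length), f k = P₁[k] := by
    intro k hk
    simp [f, hk]
  have hf : Set.InjOn f {k | k < m} := by
    intro x hx y hy h
    have hx' : x < P₁.length := by simpa [hmdef] using hx
    have hy' : y < P₁.length := by simpa [hmdef] using hy
    rw [hfk x hx', hfk y hy'] at h
    exact (hP₁nodup.getElem_inj_iff).mp h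
  have hlen : (listEdges P₁).length = m - 1 := by
    simp [listEdges, hmdef]
  have hE : ∀ k (hk : k < (listEdges P₁).length), (listEdges P₁)[k] = s(f k, f (k + 1)) := by
    intro k hk
    have h2 : k + 1 < P₁.length := by omega
    rw [hfk k (by omega), hfk (k + 1) h2]
    simp [listEdges]
  have hEmem : ∀ k, k + 1 < m → s(f k, f (k + 1)) ∈ listEdges P₁ := by
    intro k hk
    rw [← hE k (by omega)]
    exact List.getElem_mem _
  have hcinj : ∀ x y, x + 1 < m → y + 1 < m →
      c s(f x, f (x + 1)) = c s(f y, f (y + 1)) → x = y := by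
    intro x y hx hy h
    rw [← hE x (by omega), ← hE y (by omega)] at h
    have hx' : x < ((listEdges P₁).map c).length := by simp; omega
    have hy' : y < ((listEdges P₁).map c).length := by simp; omega
    refine (hP₁rainbow.getElem_inj_iff (hi := hx') (hj := hy')).mp ?_
    simpa using h
  -- choice of the crossing pair
  obtain ⟨k, hk1, hk2, ⟨p, hp, hpadj⟩, q, hq1, hq2, hqadj⟩ : ∃ k, a ≤ k + 1 ∧ k < m - a ∧
      (∃ p, p < a ∧ H₁.Adj (f p) (f (k + 1))) ∧
      (∃ q, m - a ≤ q ∧ q < m ∧ H₂.Adj (f q) (f k)) := by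
    by_contra hcon
    push Not at hcon
    let K := Finset.Ico (a - 1) (m - a)
    let K1 := K.filter (fun k => ∀ p, p < a → ¬ H₁.Adj (f p) (f (k + 1)))
    let K2 := K.filter (fun k => ∀ q, m - a ≤ q → q < m → ¬ H₂.Adj (f q) (f k))
    have hK : K ⊆ K1 ∪ K2 := by
      intro k hk
      have hk' := Finset.mem_Ico.mp hk
      by_cases h : ∀ p, p < a → ¬ H₁.Adj (f p) (f (k + 1))
      · exact Finset.mem_union_left _ (Finset.mem_filter.mpr ⟨hk, h⟩)
      · push Not at h
        obtain ⟨p, hp, hpa⟩ := h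
        exact Finset.mem_union_right _ (Finset.mem_filter.mpr
          ⟨hk, hcon k (by omega) hk'.2 ⟨p, hp, hpa⟩⟩)
    have hKc : K.card = m - a - (a - 1) := Nat.card_Ico _ _
    have h1 : (K1.image (· + 1)).card < b := by
      refine card_nonadj_lt hexp₁ f m hf (Finset.range a) _ ?_ ?_ ?_ (by simp) ?_
      · intro x hx; have := Finset.mem_range.mp hx; omega
      · intro x hx
        obtain ⟨y, hy, rfl⟩ := Finset.mem_image.mp hx
        have := Finset.mem_Ico.mp (Finset.mem_filter.mp hy).1
        omega
      · rw [Finset.disjoint_left]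
        intro x hx hx'
        obtain ⟨y, hy, rfl⟩ := Finset.mem_image.mp hx'
        have := Finset.mem_Ico.mp (Finset.mem_filter.mp hy).1
        have := Finset.mem_range.mp hx
        omega
      · intro s hs t ht
        obtain ⟨y, hy, rfl⟩ := Finset.mem_image.mp ht
        exact (Finset.mem_filter.mp hy).2 s (Finset.mem_range.mp hs)
    rw [Finset.card_image_of_injective _ (add_left_injective 1)] at h1
    have h2 : K2.card < b := by
      refine card_nonadj_lt hexp₂ f m hf (Finset.Ico (m - a) m) _ ?_ ?_ ?_
        (by rw [Nat.card_Ico]; omega) ?_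
      · intro x hx; exact (Finset.mem_Ico.mp hx).2
      · intro x hx
        have := Finset.mem_Ico.mp (Finset.mem_filter.mp hx).1
        omega
      · rw [Finset.disjoint_left]
        intro x hx hx'
        have := Finset.mem_Ico.mp (Finset.mem_filter.mp hx').1
        have := Finset.mem_Ico.mp hx
        omega
      · intro s hs t ht
        have := Finset.mem_Ico.mp hs
        exact (Finset.mem_filter.mp ht).2 s this.1 this.2
    have h3 := Finset.card_le_card hK
    have h4 := Finset.card_union_le K1 K2
    omega
  obtain ⟨d1, rfl⟩ : ∃ d, k = p + d := ⟨k - p, by omega⟩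
  obtain ⟨d2, rfl⟩ : ∃ d, q = p + d1 + 1 + d := ⟨q - (p + d1 + 1), by omega⟩
  set G := SimpleGraph.fromEdgeSet ({e | e ∈ listEdges P₁} ∪ H₁.edgeSet ∪ H₂.edgeSet) with hG
  have hGP : ∀ k, k + 1 < m → G.Adj (f k) (f (k + 1)) := by
    intro k hk
    rw [hG, SimpleGraph.fromEdgeSet_adj]
    refine ⟨Or.inl (Or.inl (hEmem k hk)), fun h => ?_⟩
    have := hf (show k < m by omega) (show k + 1 < m from hk) h
    omega
  have hG1 : G.Adj (f (p + d1 + 1)) (f p) := by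
    rw [hG, SimpleGraph.fromEdgeSet_adj]
    exact ⟨Or.inl (Or.inr hpadj.symm), hpadj.symm.ne⟩
  have hG2 : G.Adj (f (p + d1)) (f (p + d1 + 1 + d2)) := by
    rw [hG, SimpleGraph.fromEdgeSet_adj]
    exact ⟨Or.inr hqadj.symm, hqadj.symm.ne⟩
  obtain ⟨w1, hs1, he1⟩ := exists_range_walk G f d1 p (fun k _ _ => hGP k (by omega))
  obtain ⟨w2, hs2, he2⟩ := exists_range_walk G f d2 (p + d1 + 1) (fun k _ _ => hGP k (by omega))
  let w0 := w1.append (SimpleGraph.Walk.cons hG2 w2.reverse)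
  have hs0 : w0.support = (List.range' p (d1 + 1) ++
      (List.range' (p + d1 + 1) (d2 + 1)).reverse).map f := by
    simp only [w0, SimpleGraph.Walk.support_append, SimpleGraph.Walk.support_cons,
      SimpleGraph.Walk.support_reverse, hs1, hs2, List.tail_cons, List.map_append,
      List.map_reverse]
  have hpath : w0.IsPath := by
    rw [SimpleGraph.Walk.isPath_def, hs0]
    refine List.Nodup.map_on ?_ ?_
    · intro x hx y hy h
      simp only [List.mem_append, List.mem_reverse, List.mem_range'_1] at hx hy
      exact hf (show x < m by omega) (show y < m by omega) h
    · rw [List.nodup_append]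
      refine ⟨List.nodup_range', List.nodup_reverse.mpr List.nodup_range', ?_⟩
      intro x hx y hy
      simp only [List.mem_reverse, List.mem_range'_1] at hx hy
      omega
  have hPc : ∀ k, k + 1 < m → c s(f k, f (k + 1)) ∈ c '' {e | e ∈ listEdges P₁} :=
    fun k hk => ⟨_, hEmem k hk, rfl⟩
  have hC1 : c s(f (p + d1 + 1), f p) ∈ c '' H₁.edgeSet := ⟨_, hpadj.symm, rfl⟩
  have hC2 : c s(f (p + d1), f (p + d1 + 1 + d2)) ∈ c '' H₂.edgeSet := ⟨_, hqadj.symm, rfl⟩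
  have hrain : ((SimpleGraph.Walk.cons hG1 w0).edges.map c).Nodup := by
    have hperm : ((SimpleGraph.Walk.cons hG1 w0).edges.map c).Perm
        (c s(f (p + d1 + 1), f p) :: c s(f (p + d1), f (p + d1 + 1 + d2)) ::
          (List.range' p d1 ++ List.range' (p + d1 + 1) d2).map
            (fun k => c s(f k, f (k + 1)))) := by
      simp only [w0, SimpleGraph.Walk.edges_cons, SimpleGraph.Walk.edges_append,
        SimpleGraph.Walk.edges_reverse, he1, he2, List.map_cons, List.map_append,
        List.map_reverse, List.map_map]
      refine List.Perm.cons _ (List.perm_middle.trans (List.Perm.cons _ ?_))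
      exact List.Perm.append_left _ (List.reverse_perm _)
    rw [hperm.nodup_iff, List.nodup_cons, List.nodup_cons]
    refine ⟨?_, ?_, ?_⟩
    · intro h
      rcases List.mem_cons.mp h with h | h
      · exact Set.disjoint_left.mp hc₃ hC1 (h ▸ hC2)
      · obtain ⟨x, hx, hxe⟩ := List.mem_map.mp h
        simp only [List.mem_append, List.mem_range'_1] at hx
        exact Set.disjoint_left.mp hc₁ (hPc x (by omega)) (hxe ▸ hC1)
    · intro h
      obtain ⟨x, hx, hxe⟩ := List.mem_map.mp h
      simp only [List.mem_append, List.mem_range'_1] at hx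
      exact Set.disjoint_left.mp hc₂ (hPc x (by omega)) (hxe ▸ hC2)
    · refine List.Nodup.map_on ?_ ?_
      · intro x hx y hy h
        simp only [List.mem_append, List.mem_range'_1] at hx hy
        exact hcinj x y (by omega) (by omega) h
      · rw [List.nodup_append]
        refine ⟨List.nodup_range', List.nodup_range', ?_⟩
        intro x hx y hy
        simp only [List.mem_range'_1] at hx hy
        omega
  refine ⟨f (p + d1 + 1), SimpleGraph.Walk.cons hG1 w0, ?_, hrain, ?_⟩
  · rw [SimpleGraph.Walk.cons_isCycle_iff]
    refine ⟨hpath, ?_⟩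
    have h := List.Nodup.of_map c hrain
    rw [SimpleGraph.Walk.edges_cons, List.nodup_cons] at h
    exact h.1
  · have hl : w0.length + 1 = w0.support.length := (SimpleGraph.Walk.length_support _).symm
    rw [hs0] at hl
    simp only [List.length_map, List.length_append, List.length_reverse,
      List.length_range'] at hl
    rw [SimpleGraph.Walk.length_cons]
    have : m ≤ w0.length + 1 + 2 * a := by omega
    have h' : (m : ℝ) ≤ ((w0.length + 1 : ℕ) : ℝ) + 2 * a := by exact_mod_cast this
    rw [← hmdef] at hP₁len
    linarith
end
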